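/- Let X be a normal locally noetherian scheme that is locally of finite type over a quotient R₀/I of a regular commutative ring R₀. Let U be an open subscheme of X whose complement Z = X ∖ U has everywhere codimension at least 2 in X, and let i : U → X be the inclusion. Let F be a reflexive coherent sheaf of O_U-modules and let G be any coherent O_X-module with G|_U ≅ F. Then the bidual G^∨∨ is a reflexive coherent O_X-module extending F, and G^∨∨ ≅ i_*F. -/

import Mathlib

set_option linter.unusedVariables false
open CategoryTheory TopologicalSpace Opposite
universe u
variable {α : Type u} [TopologicalSpace α]

lemma map_map_apply (O : (Opens α)ᵒᵖ ⥤ CommRingCat.{u}) {A B C : Opens α}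
    (h₁ : B ≤ A) (h₂ : C ≤ B) (r : O.obj (op A)) :
    O.map (homOfLE h₂).op (O.map (homOfLE h₁).op r) = O.map (homOfLE (h₂.trans h₁)).op r := by
  rw [← comp_apply, ← O.map_comp]; rfl

lemma map_id_apply (O : (Opens α)ᵒᵖ ⥤ CommRingCat.{u}) {A : Opens α} (h : A ≤ A)
    (r : O.obj (op A)) : O.map (homOfLE h).op r = r := by
  rw [show (homOfLE h).op = 𝟙 (op A) from rfl, O.map_id]; rfl

structure OModuleOn (O : (Opens α)ᵒᵖ ⥤ CommRingCat.{u}) (U : Opens α) : Type (u + 1) where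
  sec : ∀ (W : Opens α), W ≤ U → Type u
  [secAddCommGroup : ∀ W hW, AddCommGroup (sec W hW)]
  [secModule : ∀ W hW, Module (O.obj (op W)) (sec W hW)]
  res : ∀ {W W' : Opens α} (hW : W ≤ U) (h : W' ≤ W), sec W hW → sec W' (h.trans hW)
  res_add : ∀ {W W'} (hW : W ≤ U) (h : W' ≤ W) (s t : sec W hW),
    res hW h (s + t) = res hW h s + res hW h t
  res_smul : ∀ {W W'} (hW : W ≤ U) (h : W' ≤ W) (r : O.obj (op W)) (s : sec W hW),
    res hW h (r • s) = O.map (homOfLE h).op r • res hW h s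
  res_id : ∀ (W) (hW : W ≤ U) (s : sec W hW), res hW le_rfl s = s
  res_comp : ∀ {W W' W''} (hW : W ≤ U) (h : W' ≤ W) (h' : W'' ≤ W') (s : sec W hW),
    res (h.trans hW) h' (res hW h s) = res hW (h'.trans h) s

attribute [instance] OModuleOn.secAddCommGroup OModuleOn.secModule

namespace OModuleOn
variable {O : (Opens α)ᵒᵖ ⥤ CommRingCat.{u}} {U : Opens α}

def resAddHom (F : OModuleOn O U) {W W' : Opens α} (hW : W ≤ U) (h : W' ≤ W) :
    F.sec W hW →+ F.sec W' (h.trans hW) :=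
  AddMonoidHom.mk' (F.res hW h) (F.res_add hW h)

lemma res_zero (F : OModuleOn O U) {W W' : Opens α} (hW : W ≤ U) (h : W' ≤ W) :
    F.res hW h (0 : F.sec W hW) = 0 := (F.resAddHom hW h).map_zero

lemma res_neg (F : OModuleOn O U) {W W' : Opens α} (hW : W ≤ U) (h : W' ≤ W) (s : F.sec W hW) :
    F.res hW h (-s) = -F.res hW h s := (F.resAddHom hW h).map_neg s

end OModuleOn

@[ext]
structure OModuleHom {O : (Opens α)ᵒᵖ ⥤ CommRingCat.{u}} {U : Opens α}
    (F G : OModuleOn O U) : Type u where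
  app : ∀ (W : Opens α) (hW : W ≤ U), F.sec W hW → G.sec W hW
  app_add : ∀ W hW (s t : F.sec W hW), app W hW (s + t) = app W hW s + app W hW t
  app_smul : ∀ W hW (r : O.obj (op W)) (s : F.sec W hW), app W hW (r • s) = r • app W hW s
  naturality : ∀ {W W'} (hW : W ≤ U) (h : W' ≤ W) (s : F.sec W hW),
    app W' (h.trans hW) (F.res hW h s) = G.res hW h (app W hW s)

namespace OModuleHom
variable {O : (Opens α)ᵒᵖ ⥤ CommRingCat.{u}} {U : Opens α} {F G : OModuleOn O U}

def IsIso (φ : OModuleHom F G) : Prop := ∀ W hW, Function.Bijective (φ.app W hW)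

def appAddHom (φ : OModuleHom F G) (W : Opens α) (hW : W ≤ U) :
    F.sec W hW →+ G.sec W hW :=
  AddMonoidHom.mk' (φ.app W hW) (φ.app_add W hW)

lemma app_zero (φ : OModuleHom F G) (W hW) : φ.app W hW 0 = 0 := (φ.appAddHom W hW).map_zero

lemma app_neg (φ : OModuleHom F G) (W hW) (s : F.sec W hW) :
    φ.app W hW (-s) = -φ.app W hW s := (φ.appAddHom W hW).map_neg s

instance : Zero (OModuleHom F G) :=
  ⟨{ app := fun W hW s => 0
     app_add := by intros; simp
     app_smul := by intros; simp
     naturality := by intros W W' hW h s; simp [G.res_zero] }⟩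

instance : Add (OModuleHom F G) :=
  ⟨fun φ ψ =>
    { app := fun W hW s => φ.app W hW s + ψ.app W hW s
      app_add := by intros W hW s t; rw [φ.app_add, ψ.app_add]; abel
      app_smul := by intros W hW r s; rw [φ.app_smul, ψ.app_smul, smul_add]
      naturality := by
        intros W W' hW h s
        rw [φ.naturality, ψ.naturality, G.res_add] }⟩

instance : Neg (OModuleHom F G) :=
  ⟨fun φ =>
    { app := fun W hW s => -φ.app W hW s
      app_add := by intros W hW s t; rw [φ.app_add]; abel
      app_smul := by intros W hW r s; rw [φ.app_smul, smul_neg]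
      naturality := by
        intros W W' hW h s
        rw [φ.naturality, G.res_neg] }⟩

@[simp] lemma zero_app (W hW) (s : F.sec W hW) : (0 : OModuleHom F G).app W hW s = 0 := rfl
@[simp] lemma add_app (φ ψ : OModuleHom F G) (W hW) (s : F.sec W hW) :
    (φ + ψ).app W hW s = φ.app W hW s + ψ.app W hW s := rfl
@[simp] lemma neg_app (φ : OModuleHom F G) (W hW) (s : F.sec W hW) :
    (-φ).app W hW s = -φ.app W hW s := rfl

instance : AddCommGroup (OModuleHom F G) := by
  refine
  { zero := 0, add := (· + ·), neg := Neg.neg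
    add_assoc := ?_, zero_add := ?_, add_zero := ?_, neg_add_cancel := ?_,
    add_comm := ?_, nsmul := nsmulRec, zsmul := zsmulRec } <;>
  · intros
    ext W hW s
    simp only [add_app, neg_app, zero_app]
    abel

instance : SMul (O.obj (op U)) (OModuleHom F G) :=
  ⟨fun r φ =>
    { app := fun W hW s => O.map (homOfLE hW).op r • φ.app W hW s
      app_add := by intros W hW s t; dsimp only; rw [φ.app_add, smul_add]
      app_smul := by
        intros W hW r' s; dsimp only
        rw [φ.app_smul, smul_smul, smul_smul, mul_comm]
      naturality := by
        intros W W' hW h s; dsimp only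
        rw [G.res_smul, φ.naturality, map_map_apply] }⟩

@[simp] lemma smul_app (r : O.obj (op U)) (φ : OModuleHom F G) (W : Opens α) (hW : W ≤ U)
    (s : F.sec W hW) : (r • φ).app W hW s = O.map (homOfLE hW).op r • φ.app W hW s := rfl

instance : Module (O.obj (op U)) (OModuleHom F G) where
  one_smul φ := by ext W hW s; simp
  mul_smul r r' φ := by ext W hW s; simp [map_mul, mul_smul]
  smul_zero r := by ext W hW s; simp
  smul_add r φ ψ := by ext W hW s; simp [smul_add]
  add_smul r r' φ := by ext W hW s; simp [map_add, add_smul]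
  zero_smul φ := by ext W hW s; simp

end OModuleHom

namespace OModuleOn
variable {O : (Opens α)ᵒᵖ ⥤ CommRingCat.{u}} {U : Opens α}

/-- The restriction of a sheaf of modules on `U` to an open subset `V ≤ U`. -/
def restrictTo (F : OModuleOn O U) {V : Opens α} (hV : V ≤ U) : OModuleOn O V where
  sec W hW := F.sec W (hW.trans hV)
  secAddCommGroup W hW := F.secAddCommGroup W _
  secModule W hW := F.secModule W _
  res hW h := F.res (hW.trans hV) h
  res_add hW h := F.res_add _ _
  res_smul hW h := F.res_smul _ _
  res_id W hW := F.res_id W _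
  res_comp hW h h' := F.res_comp _ _ _

/-- The pushforward `i_* F` of a sheaf of modules on `U` along the inclusion `i : U → X`;
its sections over an open `V` are the sections of `F` over `U ⊓ V`. -/
def pushforward (F : OModuleOn O U) : OModuleOn O (⊤ : Opens α) where
  sec V _ := F.sec (U ⊓ V) inf_le_left
  secAddCommGroup V _ := F.secAddCommGroup _ _
  secModule V _ := Module.compHom _ (O.map (homOfLE (inf_le_right : U ⊓ V ≤ V)).op).hom
  res {V V'} hV h := F.res inf_le_left (inf_le_inf_left U h)
  res_add hV h := F.res_add _ _
  res_smul {V V'} hV h r s := by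
    show F.res inf_le_left (inf_le_inf_left U h)
        (O.map (homOfLE (inf_le_right : U ⊓ V ≤ V)).op r • s) = _
    rw [F.res_smul]
    show _ = O.map (homOfLE (inf_le_right : U ⊓ V' ≤ V')).op (O.map (homOfLE h).op r) •
      F.res inf_le_left (inf_le_inf_left U h) s
    rw [map_map_apply, map_map_apply]
  res_id V hV s := F.res_id _ _ s
  res_comp hV h h' s := F.res_comp _ _ _ s

/-- The structure sheaf `O|_U`, viewed as a sheaf of modules over itself. -/
def unit (O : (Opens α)ᵒᵖ ⥤ CommRingCat.{u}) (U : Opens α) : OModuleOn O U where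
  sec W _ := O.obj (op W)
  secAddCommGroup W _ := inferInstance
  secModule W _ := inferInstance
  res hW h s := O.map (homOfLE h).op s
  res_add hW h s t := map_add _ s t
  res_smul hW h r s := by
    dsimp only
    rw [smul_eq_mul, smul_eq_mul, map_mul]
  res_id W hW s := map_id_apply O _ s
  res_comp hW h h' s := map_map_apply O _ _ s

/-- The sheaf `Hom` of two sheaves of modules on `U`: its sections over `W ≤ U` are the
morphisms `F|_W ⟶ G|_W`. -/
def sheafHom (F G : OModuleOn O U) : OModuleOn O U where
  sec W hW := OModuleHom (F.restrictTo hW) (G.restrictTo hW)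
  secAddCommGroup W hW := inferInstance
  secModule W hW := inferInstance
  res {W W'} hW h φ :=
    { app := fun W'' h'' s => φ.app W'' (h''.trans h) s
      app_add := fun W'' h'' => φ.app_add W'' (h''.trans h)
      app_smul := fun W'' h'' => φ.app_smul W'' (h''.trans h)
      naturality := fun h'' h''' s => φ.naturality (h''.trans h) h''' s }
  res_add hW h φ ψ := by ext W'' h'' s; rfl
  res_smul {W W'} hW h r φ := by
    ext W'' h'' s
    show O.map (homOfLE ((h''.trans h))).op r • φ.app W'' (h''.trans h) s =
      O.map (homOfLE h'').op (O.map (homOfLE h).op r) • φ.app W'' (h''.trans h) s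
    rw [map_map_apply]
  res_id W hW φ := by ext W'' h'' s; rfl
  res_comp hW h h' φ := by ext W'' h'' s; rfl

/-- The dual of a sheaf of modules. -/
def dual (F : OModuleOn O U) : OModuleOn O U := sheafHom F (unit O U)

/-- The bidual of a sheaf of modules. -/
def bidual (F : OModuleOn O U) : OModuleOn O U := dual (dual F)

end OModuleOn

namespace OModuleOn
variable {O : (Opens α)ᵒᵖ ⥤ CommRingCat.{u}} {U : Opens α}

/-- The evaluation of a section of `F` on sections of the dual of `F`. -/
def evalAt (F : OModuleOn O U) (W : Opens α) (hW : W ≤ U) (s : F.sec W hW) :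
    OModuleHom ((dual F).restrictTo hW) ((unit O U).restrictTo hW) where
  app W' h' φ := φ.app W' le_rfl (F.res hW h' s)
  app_add W' h' φ ψ := rfl
  app_smul W' h' r φ := by
    show (r • φ).app W' le_rfl (F.res hW h' s) = r • φ.app W' le_rfl (F.res hW h' s)
    exact congrArg (fun r' : O.obj (op W') => r' • φ.app W' le_rfl (F.res hW h' s))
      (map_id_apply O le_rfl r)
  naturality {W' W''} h' h'' φ := by
    show φ.app W'' h'' (F.res hW (h''.trans h') s) =
      O.map (homOfLE h'').op (φ.app W' le_rfl (F.res hW h' s))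
    rw [← F.res_comp hW h' h'' s]
    exact φ.naturality (le_refl W') h'' (F.res hW h' s)

/-- The canonical morphism from a sheaf of modules to its bidual. -/
def evalHom (F : OModuleOn O U) : OModuleHom F (bidual F) where
  app W hW s := evalAt F W hW s
  app_add W hW s t := by
    apply OModuleHom.ext
    funext W' h' φ
    show φ.app W' le_rfl (F.res hW h' (s + t)) = _
    rw [F.res_add]
    exact φ.app_add W' le_rfl _ _
  app_smul W hW r s := by
    apply OModuleHom.ext
    funext W' h' φ
    show φ.app W' le_rfl (F.res hW h' (r • s)) = _
    rw [F.res_smul]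
    exact φ.app_smul W' le_rfl _ _
  naturality {W W'} hW h s := by
    apply OModuleHom.ext
    funext W'' h'' φ
    show φ.app W'' le_rfl (F.res (h.trans hW) h'' (F.res hW h s)) =
      φ.app W'' le_rfl (F.res hW (h''.trans h) s)
    rw [F.res_comp]

/-- A sheaf of modules is reflexive if the canonical morphism to its bidual
is an isomorphism. -/
def IsReflexive (F : OModuleOn O U) : Prop := (evalHom F).IsIso

end OModuleOn

namespace OModuleOn
variable {O : (Opens α)ᵒᵖ ⥤ CommRingCat.{u}} {U : Opens α}

/-- The sections `s` generate `F` over `W`: every section of `F` on an open `W' ≤ W` is,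
locally around each point, an `O`-linear combination of the restrictions of the `s i`. -/
def Generates (F : OModuleOn O U) {W : Opens α} (hW : W ≤ U) {n : ℕ}
    (s : Fin n → F.sec W hW) : Prop :=
  ∀ (W' : Opens α) (h : W' ≤ W) (t : F.sec W' (h.trans hW)), ∀ x ∈ W',
    ∃ (W'' : Opens α) (h' : W'' ≤ W'), x ∈ W'' ∧
      ∃ a : Fin n → O.obj (op W''),
        F.res (h.trans hW) h' t = ∑ i, a i • F.res hW (h'.trans h) (s i)

/-- `F` is of finite type: locally generated by finitely many sections. -/
def IsFiniteType (F : OModuleOn O U) : Prop :=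
  ∀ x ∈ U, ∃ (W : Opens α) (hW : W ≤ U), x ∈ W ∧
    ∃ (n : ℕ) (s : Fin n → F.sec W hW), F.Generates hW s

/-- The sheaf of relations between the finitely many sections `s` of `F` is locally
finitely generated. -/
def RelationsFiniteType (F : OModuleOn O U) {W : Opens α} (hW : W ≤ U) {n : ℕ}
    (s : Fin n → F.sec W hW) : Prop :=
  ∀ x ∈ W, ∃ (V : Opens α) (hVW : V ≤ W), x ∈ V ∧
    ∃ (m : ℕ) (t : Fin m → (Fin n → O.obj (op V))),
      (∀ j, ∑ i, t j i • F.res hW hVW (s i) = 0) ∧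
      ∀ (V' : Opens α) (h' : V' ≤ V) (a : Fin n → O.obj (op V')),
        (∑ i, a i • F.res hW (h'.trans hVW) (s i) = 0) →
        ∀ y ∈ V', ∃ (V'' : Opens α) (h'' : V'' ≤ V'), y ∈ V'' ∧
          ∃ c : Fin m → O.obj (op V''),
            ∀ i, O.map (homOfLE h'').op (a i) =
              ∑ j, c j * O.map (homOfLE (h''.trans h')).op (t j i)

/-- `F` is coherent: it is of finite type, and the sheaf of relations between any finitely
many local sections is locally finitely generated. -/
def IsCoherent (F : OModuleOn O U) : Prop :=
  F.IsFiniteType ∧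
    ∀ (W : Opens α) (hW : W ≤ U) (n : ℕ) (s : Fin n → F.sec W hW),
      F.RelationsFiniteType hW s

/-- `F` is torsion-free: on every open, the module of sections is torsion-free. -/
def IsTorsionFree (F : OModuleOn O U) : Prop :=
  ∀ (W : Opens α) (hW : W ≤ U) (r : O.obj (op W)) (s : F.sec W hW),
    r ∈ nonZeroDivisors (O.obj (op W)) → r • s = 0 → s = 0

/-- Two (pre)sheaves of modules are isomorphic. -/
def AreIsomorphic (F G : OModuleOn O U) : Prop :=
  ∃ φ : OModuleHom F G, φ.IsIso

end OModuleOn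

/-- The closed subset `T` of the topological space `S` has codimension at least two:
below every irreducible closed subset contained in `T` there is a chain of length two
of irreducible closed subsets of `S`. -/
def codimAtLeastTwo (S : Type*) [TopologicalSpace S] (T : Set S) : Prop :=
  ∀ C : TopologicalSpace.IrreducibleCloseds S, (C : Set S) ⊆ T → 2 ≤ Order.coheight C

/-- The subset `Z` of the topological space `X` has everywhere codimension at least two:
for every irreducible component `Y` of `X`, the codimension of `Z ∩ Y` in `Y` is
at least two. -/
def hasEverywhereCodimAtLeastTwo {X : Type*} [TopologicalSpace X] (Z : Set X) : Prop :=
  ∀ Y ∈ irreducibleComponents X, codimAtLeastTwo Y (Subtype.val ⁻¹' Z)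

/-- A (commutative, noetherian) local ring is regular if its maximal ideal is generated by
`dim R` many elements. -/
def IsRegularLocal (R : Type*) [CommRing R] [IsLocalRing R] : Prop :=
  IsNoetherianRing R ∧ ∃ (n : ℕ) (f : Fin n → R),
    Ideal.span (Set.range f) = IsLocalRing.maximalIdeal R ∧ (n : WithBot ℕ∞) = ringKrullDim R

/-- A commutative ring is regular if it is noetherian and all of its localizations at
prime ideals are regular local rings. -/
def IsRegularCommRing (R : Type*) [CommRing R] : Prop :=
  IsNoetherianRing R ∧
    ∀ (P : Ideal R) [P.IsPrime], IsRegularLocal (Localization.AtPrime P)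

open AlgebraicGeometry in
/-- A scheme is normal if all of its local rings are integrally closed domains. -/
def IsNormalScheme (X : Scheme) : Prop :=
  ∀ x : X, IsDomain (X.presheaf.stalk x) ∧ IsIntegrallyClosed (X.presheaf.stalk x)

open AlgebraicGeometry in
/-- A scheme is regular if all of its local rings are regular local rings. -/
def IsRegularScheme (X : Scheme) : Prop :=
  ∀ x : X, IsRegularLocal (X.presheaf.stalk x)

namespace OModuleOn
variable {O : (Opens α)ᵒᵖ ⥤ CommRingCat.{u}} {U : Opens α}

/-- The sheaf condition (separation and gluing) for a presheaf of modules on `U`. -/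
def IsSheaf (F : OModuleOn O U) : Prop :=
  ∀ (W : Opens α) (hW : W ≤ U) (S : Set (Opens α)) (hS : ∀ V ∈ S, V ≤ W), W ≤ sSup S →
    (∀ s : F.sec W hW, (∀ V (hV : V ∈ S), F.res hW (hS V hV) s = 0) → s = 0) ∧
    (∀ sf : ∀ V (hV : V ∈ S), F.sec V ((hS V hV).trans hW),
      (∀ V (hV : V ∈ S) (V' : Opens α) (hV' : V' ∈ S),
        F.res ((hS V hV).trans hW) (inf_le_left : V ⊓ V' ≤ V) (sf V hV) =
        F.res ((hS V' hV').trans hW) (inf_le_right : V ⊓ V' ≤ V') (sf V' hV')) →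
      ∃ s : F.sec W hW, ∀ V (hV : V ∈ S), F.res hW (hS V hV) s = sf V hV)

end OModuleOn

namespace OModuleOn
variable {O : (Opens α)ᵒᵖ ⥤ CommRingCat.{u}}

/-- The canonical morphism `R ⟶ i_* (R|_U)` (the unit of the adjunction), for a sheaf of
modules `R` on the whole space and an open subset `U`. -/
def restrictPushforwardUnit (R : OModuleOn O (⊤ : Opens α)) (U : Opens α) :
    OModuleHom R ((R.restrictTo (le_top : U ≤ ⊤)).pushforward) where
  app V hV s := R.res hV (inf_le_right : U ⊓ V ≤ V) s
  app_add V hV s t := R.res_add hV inf_le_right s t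
  app_smul V hV r s := R.res_smul hV inf_le_right r s
  naturality {V V'} hV h s := by
    show R.res (h.trans hV) inf_le_right (R.res hV h s) =
      R.res (le_top : U ⊓ V ≤ ⊤) (inf_le_inf_left U h) (R.res hV inf_le_right s)
    rw [R.res_comp, R.res_comp]

/-- The canonical comparison morphism `i_* Hom_{O_U}(i^* D, G) ⟶ Hom_{O_X}(D, i_* G)`. -/
def homPushforwardCompare (U : Opens α) (D : OModuleOn O (⊤ : Opens α)) (G : OModuleOn O U) :
    OModuleHom ((sheafHom (D.restrictTo (le_top : U ≤ ⊤)) G).pushforward)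
      (sheafHom D G.pushforward) where
  app V hV φ :=
    { app := fun W h d =>
        φ.app (U ⊓ W) (inf_le_inf_left U h) (D.res (h.trans hV) (inf_le_right : U ⊓ W ≤ W) d)
      app_add := fun W h d d' => by
        exact (congrArg (φ.app (U ⊓ W) (inf_le_inf_left U h))
          (D.res_add (h.trans hV) (inf_le_right : U ⊓ W ≤ W) d d')).trans
          (φ.app_add (U ⊓ W) (inf_le_inf_left U h) _ _)
      app_smul := fun W h r d => by
        exact (congrArg (φ.app (U ⊓ W) (inf_le_inf_left U h))
          (D.res_smul (h.trans hV) (inf_le_right : U ⊓ W ≤ W) r d)).trans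
          (φ.app_smul (U ⊓ W) (inf_le_inf_left U h) _ _)
      naturality := fun {W W'} h h' d => by
        show φ.app (U ⊓ W') (inf_le_inf_left U (h'.trans h))
            (D.res ((h'.trans h).trans hV) inf_le_right (D.res (h.trans hV) h' d)) =
          G.res inf_le_left (inf_le_inf_left U h')
            (φ.app (U ⊓ W) (inf_le_inf_left U h) (D.res (h.trans hV) inf_le_right d))
        have := φ.naturality (inf_le_inf_left U h) (inf_le_inf_left U h')
          (D.res (h.trans hV) inf_le_right d)
        have h2 : ((D.restrictTo (le_top : U ≤ ⊤)).restrictTo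
            (inf_le_left : U ⊓ V ≤ U)).res (inf_le_inf_left U h) (inf_le_inf_left U h')
            (D.res (h.trans hV) inf_le_right d) =
            D.res (h.trans hV) ((inf_le_inf_left U h').trans inf_le_right) d := by
          show D.res _ (inf_le_inf_left U h') (D.res (h.trans hV) inf_le_right d) = _
          exact D.res_comp (h.trans hV) (inf_le_right : U ⊓ W ≤ W) (inf_le_inf_left U h') d
        exact (congrArg (φ.app (U ⊓ W') (inf_le_inf_left U (h'.trans h)))
          ((D.res_comp (h.trans hV) h' (inf_le_right : U ⊓ W' ≤ W') d).trans h2.symm)).trans this }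
  app_add V hV φ ψ := by
    apply OModuleHom.ext
    funext W h d
    rfl
  app_smul V hV r φ := by
    apply OModuleHom.ext
    funext W h d
    show O.map (homOfLE (inf_le_inf_left U h : U ⊓ W ≤ U ⊓ V)).op
        (O.map (homOfLE (inf_le_right : U ⊓ V ≤ V)).op r) •
        φ.app (U ⊓ W) (inf_le_inf_left U h) (D.res (h.trans hV) inf_le_right d) =
      O.map (homOfLE (inf_le_right : U ⊓ W ≤ W)).op (O.map (homOfLE h).op r) •
        φ.app (U ⊓ W) (inf_le_inf_left U h) (D.res (h.trans hV) inf_le_right d)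
    rw [map_map_apply, map_map_apply]
  naturality {V V'} hV h φ := by
    apply OModuleHom.ext
    funext W h' d
    show φ.app (U ⊓ W) ((inf_le_inf_left U h').trans (inf_le_inf_left U h))
        (D.res ((h'.trans h).trans hV) inf_le_right d) =
      φ.app (U ⊓ W) (inf_le_inf_left U (h'.trans h))
        (D.res ((h'.trans h).trans hV) inf_le_right d)
    rfl

end OModuleOn

open AlgebraicGeometry CategoryTheory

/-- A convenient pointwise form of the sheaf condition for a presheaf of rings. -/
structure IsGoodO (O : (Opens α)ᵒᵖ ⥤ CommRingCat.{u}) : Prop where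
  sep : ∀ (W : Opens α) (r : O.obj (op W)),
    (∀ x ∈ W, ∃ (W' : Opens α) (h : W' ≤ W), x ∈ W' ∧ O.map (homOfLE h).op r = 0) → r = 0
  glue : ∀ (W : Opens α) (P : ∀ W' : Opens α, W' ≤ W → O.obj (op W') → Prop),
    (∀ (W' W'' : Opens α) (h : W' ≤ W) (h' : W'' ≤ W') r, P W' h r →
      P W'' (h'.trans h) (O.map (homOfLE h').op r)) →
    (∀ (W' : Opens α) (h : W' ≤ W) r r', P W' h r → P W' h r' → r = r') →
    (∀ x ∈ W, ∃ (W' : Opens α) (h : W' ≤ W), x ∈ W' ∧ ∃ r, P W' h r) →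
    ∃ r : O.obj (op W), ∀ (W' : Opens α) (h : W' ≤ W) r', P W' h r' →
      O.map (homOfLE h).op r = r'

lemma isGoodO_scheme (X : Scheme.{u}) : IsGoodO (α := X) X.presheaf where
  sep W r H := by
    choose W' h hx h0 using H
    refine TopCat.Sheaf.eq_of_locally_eq' X.sheaf (fun x : W => W' x.1 x.2) W
      (fun x => homOfLE (h x.1 x.2)) ?_ r 0 ?_
    · intro x hx'
      exact Opens.mem_iSup.2 ⟨⟨x, hx'⟩, hx x hx'⟩
    · intro x
      exact (h0 x.1 x.2).trans (map_zero (X.presheaf.map (homOfLE (h x.1 x.2)).op).hom).symm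
  glue W P hres huniq hex := by
    let ι := {p : Σ W' : Opens X, X.presheaf.obj (op W') // ∃ h : p.1 ≤ W, P p.1 h p.2}
    obtain ⟨r, hr, -⟩ := TopCat.Sheaf.existsUnique_gluing' X.sheaf (fun i : ι => i.1.1) W
      (fun i => homOfLE i.2.1) (by
        intro x hx
        obtain ⟨W', h, hxW, r, hr⟩ := hex x hx
        exact Opens.mem_iSup.2 ⟨⟨⟨W', r⟩, h, hr⟩, hxW⟩) (fun i => i.1.2) (by
        intro i j
        obtain ⟨h, hP⟩ := i.2
        obtain ⟨h', hP'⟩ := j.2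
        refine huniq _ (inf_le_left.trans h) _ _ ?_ ?_
        · exact hres _ _ h inf_le_left _ hP
        · exact hres _ _ h' inf_le_right _ hP')
    exact ⟨r, fun W' h r' hP => hr ⟨⟨W', r'⟩, h, hP⟩⟩

lemma IsGoodO.sep₂ {O : (Opens α)ᵒᵖ ⥤ CommRingCat.{u}} (hO : IsGoodO O) (W : Opens α)
    (r r' : O.obj (op W))
    (H : ∀ x ∈ W, ∃ (W' : Opens α) (h : W' ≤ W), x ∈ W' ∧
      O.map (homOfLE h).op r = O.map (homOfLE h).op r') : r = r' := by
  rw [← sub_eq_zero]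
  refine hO.sep W _ fun x hx => ?_
  obtain ⟨W', h, hxW, e⟩ := H x hx
  exact ⟨W', h, hxW, by rw [map_sub, e, sub_self]⟩

namespace OModuleOn
variable {O : (Opens α)ᵒᵖ ⥤ CommRingCat.{u}} {U : Opens α}

lemma res_sum (F : OModuleOn O U) {W W' : Opens α} (hW : W ≤ U) (h : W' ≤ W) {n : ℕ}
    (s : Fin n → F.sec W hW) : F.res hW h (∑ i, s i) = ∑ i, F.res hW h (s i) :=
  map_sum (F.resAddHom hW h) s Finset.univ

lemma res_sub (F : OModuleOn O U) {W W' : Opens α} (hW : W ≤ U) (h : W' ≤ W)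
    (s t : F.sec W hW) : F.res hW h (s - t) = F.res hW h s - F.res hW h t :=
  (F.resAddHom hW h).map_sub s t

lemma res_lin (F : OModuleOn O U) {W W' W'' : Opens α} (hW : W ≤ U) (h : W' ≤ W) (h' : W'' ≤ W')
    {n : ℕ} (a : Fin n → O.obj (op W')) (s : Fin n → F.sec W hW) :
    F.res (h.trans hW) h' (∑ i, a i • F.res hW h (s i)) =
      ∑ i, O.map (homOfLE h').op (a i) • F.res hW (h'.trans h) (s i) := by
  rw [res_sum]
  refine Finset.sum_congr rfl fun i _ => ?_
  rw [F.res_smul, F.res_comp]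

end OModuleOn

namespace OModuleHom
variable {O : (Opens α)ᵒᵖ ⥤ CommRingCat.{u}} {U : Opens α} {F G : OModuleOn O U}

lemma app_sub (φ : OModuleHom F G) (W hW) (s t : F.sec W hW) :
    φ.app W hW (s - t) = φ.app W hW s - φ.app W hW t := (φ.appAddHom W hW).map_sub s t

lemma app_lin (φ : OModuleHom F G) (W hW) {n : ℕ} (a : Fin n → O.obj (op W))
    (s : Fin n → F.sec W hW) :
    φ.app W hW (∑ i, a i • s i) = ∑ i, a i • φ.app W hW (s i) := by
  refine (map_sum (φ.appAddHom W hW) _ Finset.univ).trans ?_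
  exact Finset.sum_congr rfl fun i _ => φ.app_smul W hW _ _

end OModuleHom

namespace OModuleOn
variable {O : (Opens α)ᵒᵖ ⥤ CommRingCat.{u}} {U : Opens α}

/-- Build an element of the dual over `W`. -/
def mkDual (F : OModuleOn O U) {W : Opens α} (hW : W ≤ U)
    (app : ∀ (W' : Opens α) (h : W' ≤ W), F.sec W' (h.trans hW) → O.obj (op W'))
    (app_add : ∀ W' h s t, app W' h (s + t) = app W' h s + app W' h t)
    (app_smul : ∀ W' h (r : O.obj (op W')) s, app W' h (r • s) = r * app W' h s)
    (nat : ∀ W' h W'' (h' : W'' ≤ W') s, app W'' (h'.trans h) (F.res (h.trans hW) h' s) =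
      O.map (homOfLE h').op (app W' h s)) : F.dual.sec W hW :=
  { app := app, app_add := app_add, app_smul := app_smul,
    naturality := fun hW h s => nat _ hW _ h s }

/-- Evaluate an element of the dual. -/
def ev (F : OModuleOn O U) {W : Opens α} (hW : W ≤ U) (φ : F.dual.sec W hW)
    (W' : Opens α) (h : W' ≤ W) (s : F.sec W' (h.trans hW)) : O.obj (op W') :=
  OModuleHom.app φ W' h s

lemma ev_mkDual (F : OModuleOn O U) {W : Opens α} (hW : W ≤ U) (app a b c)
    (W' : Opens α) (h : W' ≤ W) (s : F.sec W' (h.trans hW)) :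
    F.ev hW (F.mkDual hW app a b c) W' h s = app W' h s := rfl

section
variable (F : OModuleOn O U) {W : Opens α} (hW : W ≤ U) (φ ψ : F.dual.sec W hW)
  (W' : Opens α) (h : W' ≤ W)

variable {F} in
lemma ev_ext {φ ψ : F.dual.sec W hW} (H : ∀ W' h s, F.ev hW φ W' h s = F.ev hW ψ W' h s) :
    φ = ψ := by
  apply OModuleHom.ext
  funext W' h s
  exact H W' h s

lemma ev_add (s t) : F.ev hW φ W' h (s + t) = F.ev hW φ W' h s + F.ev hW φ W' h t :=
  OModuleHom.app_add φ W' h s t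
lemma ev_sub (s t) : F.ev hW φ W' h (s - t) = F.ev hW φ W' h s - F.ev hW φ W' h t :=
  OModuleHom.app_sub φ W' h s t
lemma ev_zero : F.ev hW φ W' h 0 = 0 := OModuleHom.app_zero φ W' h
lemma ev_smul (r : O.obj (op W')) (s) : F.ev hW φ W' h (r • s) = r * F.ev hW φ W' h s :=
  OModuleHom.app_smul φ W' h r s
lemma ev_lin {n : ℕ} (a : Fin n → O.obj (op W')) (s : Fin n → F.sec W' (h.trans hW)) :
    F.ev hW φ W' h (∑ i, a i • s i) = ∑ i, a i * F.ev hW φ W' h (s i) :=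
  OModuleHom.app_lin φ W' h a s
lemma ev_nat (W'' : Opens α) (h' : W'' ≤ W') (s) :
    F.ev hW φ W'' (h'.trans h) (F.res (h.trans hW) h' s) =
      O.map (homOfLE h').op (F.ev hW φ W' h s) :=
  OModuleHom.naturality φ h h' s
lemma ev_res (W'' : Opens α) (h' : W'' ≤ W') (s) :
    F.ev (h.trans hW) (F.dual.res hW h φ) W'' h' s = F.ev hW φ W'' (h'.trans h) s := rfl
lemma add_ev (s) : F.ev hW (φ + ψ) W' h s = F.ev hW φ W' h s + F.ev hW ψ W' h s := rfl
lemma zero_ev (s) : F.ev hW 0 W' h s = 0 := rfl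
lemma smul_ev (r : O.obj (op W)) (s) :
    F.ev hW (r • φ) W' h s = O.map (homOfLE h).op r * F.ev hW φ W' h s := rfl
lemma lin_ev {n : ℕ} (a : Fin n → O.obj (op W)) (f : Fin n → F.dual.sec W hW) (s) :
    F.ev hW (∑ i, a i • f i) W' h s = ∑ i, O.map (homOfLE h).op (a i) * F.ev hW (f i) W' h s := by
  let e : F.dual.sec W hW →+ O.obj (op W') :=
    AddMonoidHom.mk' (fun φ => F.ev hW φ W' h s) (fun φ ψ => add_ev F hW φ ψ W' h s)
  exact map_sum e _ Finset.univ
end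

/-- The dual of anything is a sheaf. -/
lemma dual_isSheaf (hO : IsGoodO O) (F : OModuleOn O U) : F.dual.IsSheaf := by
  intro W hW S hS hcov
  have hc : ∀ W' ≤ W, ∀ x ∈ W', ∃ V ∈ S, x ∈ V := by
    intro W' h x hx
    have := hcov (h hx)
    simpa using this
  constructor
  · intro φ hφ
    apply ev_ext
    intro W' h s
    rw [zero_ev]
    refine hO.sep _ _ fun x hx => ?_
    obtain ⟨V, hV, hxV⟩ := hc W' h x hx
    refine ⟨W' ⊓ V, inf_le_left, ⟨hx, hxV⟩, ?_⟩
    rw [← ev_nat]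
    have := congrArg (fun ψ => F.ev ((hS V hV).trans hW) ψ (W' ⊓ V) inf_le_right
      (F.res (h.trans hW) inf_le_left s)) (hφ V hV)
    exact this
  · intro sf hsf
    have key : ∀ (W' : Opens α) (h : W' ≤ W) (s : F.sec W' (h.trans hW)),
        ∃ r : O.obj (op W'), ∀ (V : Opens α) (hV : V ∈ S) (W'' : Opens α) (h' : W'' ≤ W')
          (h'' : W'' ≤ V), O.map (homOfLE h').op r =
            F.ev _ (sf V hV) W'' h'' (F.res (h.trans hW) h' s) := by
      intro W' h s
      refine Exists.imp (fun r hr V hV W'' h' h'' => hr W'' h' _ ⟨V, hV, h'', rfl⟩)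
        (hO.glue W' (fun W'' h' r => ∃ (V : Opens α) (hV : V ∈ S) (h'' : W'' ≤ V),
        r = F.ev _ (sf V hV) W'' h'' (F.res (h.trans hW) h' s)) ?_ ?_ ?_)
      · rintro W₁ W₂ h₁ h₂ r ⟨V, hV, h'', rfl⟩
        refine ⟨V, hV, h₂.trans h'', ?_⟩
        rw [← ev_nat, F.res_comp]
      · rintro W₁ h₁ r r' ⟨V, hV, h'', rfl⟩ ⟨V', hV', h''', rfl⟩
        exact congrArg (fun ψ => F.ev _ ψ W₁ (le_inf h'' h''') (F.res (h.trans hW) h₁ s))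
          (hsf V hV V' hV')
      · intro x hx
        obtain ⟨V, hV, hxV⟩ := hc W' h x hx
        exact ⟨W' ⊓ V, inf_le_left, ⟨hx, hxV⟩, _, V, hV, inf_le_right, rfl⟩
    choose app happ using key
    have hloc : ∀ (W' : Opens α) (h : W' ≤ W) (r r' : O.obj (op W')),
        (∀ (V : Opens α) (hV : V ∈ S) (W'' : Opens α) (h' : W'' ≤ W') (h'' : W'' ≤ V),
          O.map (homOfLE h').op r = O.map (homOfLE h').op r') → r = r' := by
      intro W' h r r' H
      refine hO.sep₂ _ _ _ fun x hx => ?_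
      obtain ⟨V, hV, hxV⟩ := hc W' h x hx
      exact ⟨W' ⊓ V, inf_le_left, ⟨hx, hxV⟩, H V hV _ _ inf_le_right⟩
    refine ⟨F.mkDual hW app ?_ ?_ ?_, ?_⟩
    · intro W' h s t
      refine hloc W' h _ _ fun V hV W'' h' h'' => ?_
      rw [map_add, happ W' h _ V hV W'' h' h'', happ W' h _ V hV W'' h' h'',
        happ W' h _ V hV W'' h' h'', F.res_add, ev_add]
    · intro W' h r s
      refine hloc W' h _ _ fun V hV W'' h' h'' => ?_
      rw [map_mul, happ W' h _ V hV W'' h' h'', happ W' h _ V hV W'' h' h'', F.res_smul, ev_smul]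
    · intro W₁ h₁ W₂ h₂ s
      refine hloc W₂ (h₂.trans h₁) _ _ fun V hV W'' h' h'' => ?_
      rw [happ W₂ _ _ V hV W'' h' h'', map_map_apply, happ W₁ h₁ s V hV W'' (h'.trans h₂) h'',
        F.res_comp]
    · intro V hV
      apply ev_ext
      intro W' h s
      rw [ev_res, ev_mkDual, ← map_id_apply O le_rfl (app _ _ _), happ W' _ s V hV W' le_rfl h]
      rw [F.res_id]

end OModuleOn

/-- Coherence of a presheaf of rings: solution sheaves of linear systems are locally
finitely generated. -/
def IsCohO (O : (Opens α)ᵒᵖ ⥤ CommRingCat.{u}) : Prop :=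
  ∀ (W : Opens α) (q p : ℕ) (M : Fin q → Fin p → O.obj (op W)), ∀ x ∈ W,
    ∃ (V : Opens α) (hV : V ≤ W), x ∈ V ∧ ∃ (m : ℕ) (t : Fin m → Fin q → O.obj (op V)),
      (∀ j k, ∑ i, t j i * O.map (homOfLE hV).op (M i k) = 0) ∧
      ∀ (V' : Opens α) (h' : V' ≤ V) (a : Fin q → O.obj (op V')),
        (∀ k, ∑ i, a i * O.map (homOfLE (h'.trans hV)).op (M i k) = 0) →
        ∀ y ∈ V', ∃ (V'' : Opens α) (h'' : V'' ≤ V'), y ∈ V'' ∧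
          ∃ c : Fin m → O.obj (op V''),
            ∀ i, O.map (homOfLE h'').op (a i) =
              ∑ j, c j * O.map (homOfLE (h''.trans h')).op (t j i)

namespace OModuleOn
variable {O : (Opens α)ᵒᵖ ⥤ CommRingCat.{u}} {U : Opens α}

lemma Generates.mono {F : OModuleOn O U} {W : Opens α} {hW : W ≤ U} {n : ℕ}
    {s : Fin n → F.sec W hW} (H : F.Generates hW s) {V : Opens α} (h : V ≤ W) :
    F.Generates (h.trans hW) (fun i => F.res hW h (s i)) := by
  intro W' h' t x hx
  obtain ⟨W'', h'', hxW, a, ha⟩ := H W' (h'.trans h) t x hx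
  refine ⟨W'', h'', hxW, a, ha.trans ?_⟩
  refine Finset.sum_congr rfl fun i _ => ?_
  rw [F.res_comp]

lemma ev_eq_of_generates (hO : IsGoodO O) {F : OModuleOn O U} {W : Opens α} {hW : W ≤ U} {n : ℕ}
    {s : Fin n → F.sec W hW} (H : F.Generates hW s) (φ ψ : F.dual.sec W hW)
    (h : ∀ i, F.ev hW φ W le_rfl (s i) = F.ev hW ψ W le_rfl (s i)) : φ = ψ := by
  apply ev_ext
  intro W' h' t
  refine hO.sep₂ _ _ _ fun x hx => ?_
  obtain ⟨W'', h'', hxW, a, ha⟩ := H W' h' t x hx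
  refine ⟨W'', h'', hxW, ?_⟩
  rw [← ev_nat, ← ev_nat, ha, ev_lin, ev_lin]
  refine Finset.sum_congr rfl fun i _ => ?_
  have e1 := F.ev_nat hW φ W le_rfl W'' (h''.trans h') (s i)
  have e2 := F.ev_nat hW ψ W le_rfl W'' (h''.trans h') (s i)
  rw [e1, e2, h]

lemma exists_dual (hO : IsGoodO O) {F : OModuleOn O U} {W : Opens α} {hW : W ≤ U} {n : ℕ}
    {s : Fin n → F.sec W hW} (H : F.Generates hW s) (a : Fin n → O.obj (op W))
    (hrel : ∀ (V : Opens α) (h : V ≤ W) (c : Fin n → O.obj (op V)),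
      ∑ i, c i • F.res hW h (s i) = 0 → ∑ i, c i * O.map (homOfLE h).op (a i) = 0) :
    ∃ φ : F.dual.sec W hW, ∀ i, F.ev hW φ W le_rfl (s i) = a i := by
  have key : ∀ (W' : Opens α) (h : W' ≤ W) (t : F.sec W' (h.trans hW)),
      ∃ r : O.obj (op W'), ∀ (W'' : Opens α) (h' : W'' ≤ W') (c : Fin n → O.obj (op W'')),
        F.res (h.trans hW) h' t = ∑ i, c i • F.res hW (h'.trans h) (s i) →
        O.map (homOfLE h').op r = ∑ i, c i * O.map (homOfLE (h'.trans h)).op (a i) := by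
    intro W' h t
    refine Exists.imp (fun r hr W'' h' c hc => hr W'' h' _ ⟨c, hc, rfl⟩)
      (hO.glue W' (fun W'' h' r => ∃ c : Fin n → O.obj (op W''),
        F.res (h.trans hW) h' t = ∑ i, c i • F.res hW (h'.trans h) (s i) ∧
        r = ∑ i, c i * O.map (homOfLE (h'.trans h)).op (a i)) ?_ ?_ ?_)
    · rintro W₁ W₂ h₁ h₂ r ⟨c, hc, rfl⟩
      refine ⟨fun i => O.map (homOfLE h₂).op (c i), ?_, ?_⟩
      · rw [← F.res_comp _ h₁ h₂, hc, res_lin]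
      · rw [map_sum]
        refine Finset.sum_congr rfl fun i _ => ?_
        rw [map_mul, map_map_apply]
    · rintro W₁ h₁ r r' ⟨c, hc, rfl⟩ ⟨c', hc', rfl⟩
      rw [← sub_eq_zero, ← Finset.sum_sub_distrib]
      simp_rw [← sub_mul]
      apply hrel W₁ (h₁.trans h) (fun i => c i - c' i)
      simp_rw [sub_smul]
      rw [Finset.sum_sub_distrib, ← hc, ← hc', sub_self]
    · intro x hx
      obtain ⟨W'', h', hxW, c, hc⟩ := H W' h t x hx
      exact ⟨W'', h', hxW, _, c, hc, rfl⟩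
  choose app happ using key
  have app_eq : ∀ W' h t (r : O.obj (op W')), (∀ x ∈ W', ∃ (W₁ : Opens α) (h₁ : W₁ ≤ W'),
      x ∈ W₁ ∧ ∀ (W'' : Opens α) (h' : W'' ≤ W₁) (c : Fin n → O.obj (op W'')),
        F.res (h.trans hW) (h'.trans h₁) t = ∑ i, c i • F.res hW ((h'.trans h₁).trans h) (s i) →
        O.map (homOfLE (h'.trans h₁)).op r =
          ∑ i, c i * O.map (homOfLE ((h'.trans h₁).trans h)).op (a i)) → app W' h t = r := by
    intro W' h t r hr
    refine hO.sep₂ _ _ _ fun x hx => ?_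
    obtain ⟨W₁, h₁, hx₁, hr₁⟩ := hr x hx
    obtain ⟨W'', h', hxW, c, hc⟩ := H W₁ (h₁.trans h) (F.res (h.trans hW) h₁ t) x hx₁
    rw [F.res_comp] at hc
    exact ⟨W'', h'.trans h₁, hxW, by rw [happ W' h t W'' (h'.trans h₁) c hc, hr₁ W'' h' c hc]⟩
  refine ⟨F.mkDual hW app ?_ ?_ ?_, ?_⟩
  · intro W' h t t'
    refine app_eq _ _ _ _ fun x hx => ?_
    obtain ⟨W₁, h₁, hx₁, c₁, hc₁⟩ := H W' h t x hx
    refine ⟨W₁, h₁, hx₁, fun W'' h' c hc => ?_⟩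
    rw [map_add]
    have e1 : F.res (h.trans hW) (h'.trans h₁) t =
        ∑ i, (O.map (homOfLE h').op (c₁ i)) • F.res hW ((h'.trans h₁).trans h) (s i) := by
      rw [← F.res_comp _ h₁ h', hc₁, res_lin]
    have e2 : F.res (h.trans hW) (h'.trans h₁) t' =
        ∑ i, (c i - O.map (homOfLE h').op (c₁ i)) • F.res hW ((h'.trans h₁).trans h) (s i) := by
      simp_rw [sub_smul]
      rw [Finset.sum_sub_distrib, ← hc, ← e1, F.res_add, add_sub_cancel_left]
    rw [happ _ _ _ _ _ _ e1, happ _ _ _ _ _ _ e2, ← Finset.sum_add_distrib]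
    refine Finset.sum_congr rfl fun i _ => ?_
    ring
  · intro W' h r t
    refine hO.sep₂ _ _ _ fun x hx => ?_
    obtain ⟨W₁, h₁, hx₁, c₁, hc₁⟩ := H W' h t x hx
    refine ⟨W₁, h₁, hx₁, ?_⟩
    rw [map_mul, happ _ _ _ _ _ _ hc₁, happ W' h (r • t) W₁ h₁
      (fun i => O.map (homOfLE h₁).op r * c₁ i), Finset.mul_sum]
    · refine Finset.sum_congr rfl fun i _ => ?_
      ring
    · rw [F.res_smul, hc₁, Finset.smul_sum]
      simp_rw [mul_smul]
  · intro W' h W'' h' t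
    refine hO.sep₂ _ _ _ fun x hx => ?_
    obtain ⟨W₁, h₁, hx₁, c₁, hc₁⟩ := H W'' (h'.trans h) (F.res (h.trans hW) h' t) x hx
    refine ⟨W₁, h₁, hx₁, ?_⟩
    rw [happ _ _ _ _ _ _ hc₁, map_map_apply]
    rw [F.res_comp] at hc₁
    rw [happ _ _ _ _ _ _ hc₁]
  · intro i
    rw [ev_mkDual, ← map_id_apply O le_rfl (app _ _ _),
      happ W le_rfl (s i) W le_rfl (fun j => if j = i then 1 else 0)]
    · simp
    · simp

lemma dual_isCoherent (hO : IsGoodO O) (hK : IsCohO O) {F : OModuleOn O U} (hF : F.IsCoherent) :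
    F.dual.IsCoherent := by
  obtain ⟨hft, hrel⟩ := hF
  constructor
  · intro x hx
    obtain ⟨W, hW, hxW, n, s, hs⟩ := hft x hx
    obtain ⟨V, hVW, hxV, m, t, ht0, ht⟩ := hrel W hW n s x hxW
    obtain ⟨V₁, hV₁, hxV₁, l, b, hb0, hb⟩ := hK V n m (fun i j => t j i) x hxV
    have hs₁ := hs.mono (hV₁.trans hVW)
    have hφ : ∀ k, ∃ φ : F.dual.sec V₁ ((hV₁.trans hVW).trans hW),
        ∀ i, F.ev _ φ V₁ le_rfl (F.res hW (hV₁.trans hVW) (s i)) = b k i := by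
      intro k
      refine exists_dual hO hs₁ (b k) fun V' h c hc => ?_
      simp_rw [F.res_comp] at hc
      refine hO.sep _ _ fun y hy => ?_
      obtain ⟨V'', h'', hyV, d, hd⟩ := ht V' (h.trans hV₁) c hc y hy
      refine ⟨V'', h'', hyV, ?_⟩
      rw [map_sum]
      have hb' : ∀ j, ∑ i, O.map (homOfLE (h''.trans (h.trans hV₁))).op (t j i) *
          O.map (homOfLE (h''.trans h)).op (b k i) = 0 := by
        intro j
        have := congrArg (O.map (homOfLE (h''.trans h)).op) (hb0 k j)
        rw [map_sum, map_zero] at this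
        rw [← this]
        refine Finset.sum_congr rfl fun i _ => ?_
        rw [map_mul, map_map_apply, mul_comm]
      calc _ = ∑ i, ∑ j, d j * (O.map (homOfLE (h''.trans (h.trans hV₁))).op (t j i) *
          O.map (homOfLE (h''.trans h)).op (b k i)) := by
            refine Finset.sum_congr rfl fun i _ => ?_
            rw [map_mul, map_map_apply, hd, Finset.sum_mul]
            simp_rw [mul_assoc]
        _ = 0 := by
            rw [Finset.sum_comm]
            refine Finset.sum_eq_zero fun j _ => ?_
            rw [← Finset.mul_sum, hb' j, mul_zero]
    choose φ hφ using hφ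
    refine ⟨V₁, (hV₁.trans hVW).trans hW, hxV₁, l, φ, ?_⟩
    intro W' h lam y hy
    have hsol : ∀ j, ∑ i, F.ev _ lam W' le_rfl (F.res hW (h.trans (hV₁.trans hVW)) (s i)) *
        O.map (homOfLE (h.trans hV₁)).op (t j i) = 0 := by
      intro j
      have h0 := congrArg (F.res (hVW.trans hW) (h.trans hV₁)) (ht0 j)
      rw [res_lin, F.res_zero] at h0
      have := congrArg (F.ev _ lam W' le_rfl) h0
      rw [ev_lin, ev_zero] at this
      rw [← this]
      refine Finset.sum_congr rfl fun i _ => ?_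
      rw [mul_comm]
    obtain ⟨V'', h'', hyV, c, hc⟩ := hb W' h _ hsol y hy
    refine ⟨V'', h'', hyV, c, ?_⟩
    refine ev_eq_of_generates hO (hs.mono ((h''.trans h).trans (hV₁.trans hVW))) _ _ fun i => ?_
    rw [ev_res, lin_ev]
    simp_rw [ev_res, map_id_apply]
    have e1 := F.ev_nat _ lam W' le_rfl V'' h'' (F.res hW (h.trans (hV₁.trans hVW)) (s i))
    rw [F.res_comp] at e1
    rw [e1, hc]
    refine Finset.sum_congr rfl fun k _ => ?_
    have e2 := F.ev_nat _ (φ k) V₁ le_rfl V'' (h''.trans h) (F.res hW (hV₁.trans hVW) (s i))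
    rw [F.res_comp, hφ] at e2
    rw [e2]
  · intro W₀ hW₀ k φ x hx
    obtain ⟨W, hW, hxW, n, s, hs⟩ := hft x (hW₀ hx)
    have hV₁ : W₀ ⊓ W ≤ W₀ := inf_le_left
    have hV₂ : W₀ ⊓ W ≤ W := inf_le_right
    obtain ⟨V, hV, hxV, m, t, ht0, ht⟩ := hK (W₀ ⊓ W) k n
      (fun j i => F.ev hW₀ (φ j) (W₀ ⊓ W) hV₁ (F.res hW hV₂ (s i))) x ⟨hx, hxW⟩
    have hev : ∀ (V' : Opens α) (h : V' ≤ V) j i,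
        F.ev hW₀ (φ j) V' (h.trans (hV.trans hV₁)) (F.res hW (h.trans (hV.trans hV₂)) (s i)) =
        O.map (homOfLE (h.trans hV)).op
          (F.ev hW₀ (φ j) (W₀ ⊓ W) hV₁ (F.res hW hV₂ (s i))) := by
      intro V' h j i
      rw [← ev_nat, F.res_comp]
    refine ⟨V, hV.trans hV₁, hxV, m, t, ?_, ?_⟩
    · intro j
      refine ev_eq_of_generates hO (hs.mono (hV.trans hV₂)) _ _ fun i => ?_
      rw [zero_ev, lin_ev, ← ht0 j i]
      refine Finset.sum_congr rfl fun i' _ => ?_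
      rw [ev_res, map_id_apply, ← hev V le_rfl]
    · intro V' h' a ha y hy
      refine ht V' h' a (fun i => ?_) y hy
      have := congrArg (fun ψ => F.ev _ ψ V' le_rfl (F.res hW (h'.trans (hV.trans hV₂)) (s i))) ha
      simp only [lin_ev, zero_ev, ev_res, map_id_apply] at this
      rw [← this]
      refine Finset.sum_congr rfl fun i' _ => ?_
      rw [← hev V' h']

end OModuleOn

/-- Reducedness in the form needed: a nonzero function is invertible on a nonempty open. -/
structure IsRedO (O : (Opens α)ᵒᵖ ⥤ CommRingCat.{u}) : Prop where
  unit : ∀ (W : Opens α) (r : O.obj (op W)), r ≠ 0 →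
    ∃ (V : Opens α) (h : V ≤ W), (V : Set α).Nonempty ∧ IsUnit (O.map (homOfLE h).op r)
  nontriv : ∀ (W : Opens α), (W : Set α).Nonempty → Nontrivial (O.obj (op W))

namespace OModuleOn
variable {O : (Opens α)ᵒᵖ ⥤ CommRingCat.{u}} {U : Opens α}

lemma generates_succAbove {F : OModuleOn O U} {W : Opens α} {hW : W ≤ U} {n : ℕ}
    {s : Fin (n + 1) → F.sec W hW} (H : F.Generates hW s) (a : Fin (n + 1) → O.obj (op W))
    (ha : ∑ i, a i • s i = 0) (i : Fin (n + 1)) (hi : IsUnit (a i)) :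
    F.Generates hW (fun j => s (i.succAbove j)) := by
  obtain ⟨b, hb⟩ := hi.exists_left_inv
  have hsi : s i = ∑ j, (-(b * a (i.succAbove j))) • s (i.succAbove j) := by
    rw [Fin.sum_univ_succAbove _ i] at ha
    have h2 : s i = b • (a i • s i) := by rw [smul_smul, hb, one_smul]
    rw [h2, eq_neg_of_add_eq_zero_left ha, smul_neg, Finset.smul_sum, ← Finset.sum_neg_distrib]
    refine Finset.sum_congr rfl fun j _ => ?_
    rw [neg_smul, smul_smul]
  intro W' h t x hx
  obtain ⟨W'', h', hxW, c, hc⟩ := H W' h t x hx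
  refine ⟨W'', h', hxW, fun j => c (i.succAbove j) +
    c i * O.map (homOfLE (h'.trans h)).op (-(b * a (i.succAbove j))), ?_⟩
  have hres : F.res hW (h'.trans h) (s i) =
      ∑ j, O.map (homOfLE (h'.trans h)).op (-(b * a (i.succAbove j))) •
        F.res hW (h'.trans h) (s (i.succAbove j)) := by
    rw [hsi, res_sum]
    refine Finset.sum_congr rfl fun j _ => ?_
    rw [F.res_smul]
  rw [hc, Fin.sum_univ_succAbove _ i, hres, Finset.smul_sum, ← Finset.sum_add_distrib]
  refine Finset.sum_congr rfl fun j _ => ?_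
  rw [smul_smul, add_smul, add_comm]

lemma exists_free (hR : IsRedO O) {F : OModuleOn O U} :
    ∀ (n : ℕ) (W : Opens α) (hW : W ≤ U) (hne : (W : Set α).Nonempty) (s : Fin n → F.sec W hW)
      (H : F.Generates hW s), ∃ (V : Opens α) (hV : V ≤ W), (V : Set α).Nonempty ∧
      ∃ (m : ℕ) (e : Fin m → F.sec V (hV.trans hW)), F.Generates (hV.trans hW) e ∧
        ∀ (V' : Opens α) (h : V' ≤ V) (c : Fin m → O.obj (op V')),
          ∑ i, c i • F.res (hV.trans hW) h (e i) = 0 → c = 0 := by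
  intro n
  induction n with
  | zero =>
    intro W hW hne s H
    refine ⟨W, le_rfl, hne, 0, s, H, fun V' h c hc => Subsingleton.elim _ _⟩
  | succ n ih =>
    intro W hW hne s H
    by_cases hno : ∀ (V' : Opens α) (h : V' ≤ W) (c : Fin (n + 1) → O.obj (op V')),
          ∑ i, c i • F.res hW h (s i) = 0 → c = 0
    · exact ⟨W, le_rfl, hne, n + 1, s, H, hno⟩
    · push Not at hno
      obtain ⟨V', h, c, hc, hc0⟩ := hno
      obtain ⟨i, hi⟩ := Function.ne_iff.1 hc0
      obtain ⟨V, hV, hVne, hu⟩ := hR.unit V' (c i) hi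
      have H' := generates_succAbove (H.mono (hV.trans h)) (fun j => O.map (homOfLE hV).op (c j))
        ((F.res_lin hW h hV c s).symm.trans (by rw [hc, F.res_zero])) i hu
      obtain ⟨V₂, hV₂, hne₂, m, e, he, hrel⟩ := ih V _ hVne _ H'
      exact ⟨V₂, hV₂.trans (hV.trans h), hne₂, m, e, he, hrel⟩

/-- The evaluation morphism on sections, with values in the dual of the dual. -/
def toBi (F : OModuleOn O U) {W : Opens α} (hW : W ≤ U) (s : F.sec W hW) : F.dual.dual.sec W hW :=
  (evalHom F).app W hW s

lemma ev_toBi (F : OModuleOn O U) {W : Opens α} (hW : W ≤ U) (s : F.sec W hW)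
    (W' : Opens α) (h : W' ≤ W) (φ : F.dual.sec W' (h.trans hW)) :
    F.dual.ev hW (F.toBi hW s) W' h φ = F.ev (h.trans hW) φ W' le_rfl (F.res hW h s) :=
  rfl

lemma toBi_add (F : OModuleOn O U) {W : Opens α} (hW : W ≤ U) (s t : F.sec W hW) :
    F.toBi hW (s + t) = F.toBi hW s + F.toBi hW t := (evalHom F).app_add W hW s t

lemma toBi_smul (F : OModuleOn O U) {W : Opens α} (hW : W ≤ U) (r : O.obj (op W))
    (s : F.sec W hW) : F.toBi hW (r • s) = r • F.toBi hW s := (evalHom F).app_smul W hW r s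

lemma toBi_res (F : OModuleOn O U) {W W' : Opens α} (hW : W ≤ U) (h : W' ≤ W)
    (s : F.sec W hW) : F.toBi (h.trans hW) (F.res hW h s) = F.dual.dual.res hW h (F.toBi hW s) :=
  (evalHom F).naturality hW h s

lemma evalHom_surjective_of_free (hO : IsGoodO O) {F : OModuleOn O U} {V : Opens α} (hV : V ≤ U)
    {m : ℕ} (e : Fin m → F.sec V hV) (he : F.Generates hV e)
    (hrel : ∀ (V' : Opens α) (h : V' ≤ V) (c : Fin m → O.obj (op V')),
          ∑ i, c i • F.res hV h (e i) = 0 → c = 0) (χ : F.dual.dual.sec V hV) :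
    ∃ s, F.toBi hV s = χ := by
  have hd : ∀ i : Fin m, ∃ φ : F.dual.sec V hV, ∀ j, F.ev hV φ V le_rfl (e j) =
      if j = i then 1 else 0 := by
    intro i
    refine exists_dual hO he _ fun V' h c hc => ?_
    rw [hrel V' h c hc]
    simp
  choose d hd using hd
  refine ⟨∑ i, F.dual.ev hV χ V le_rfl (d i) • e i, ?_⟩
  refine F.dual.ev_ext hV fun W' h lam => ?_
  rw [ev_toBi]
  have hl : lam = ∑ i, F.ev _ lam W' le_rfl (F.res hV h (e i)) • F.dual.res hV h (d i) := by
    refine ev_eq_of_generates hO (he.mono h) _ _ fun j => ?_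
    rw [lin_ev]
    have : ∀ i, F.ev (h.trans hV) (F.dual.res hV h (d i)) W' le_rfl (F.res hV h (e j)) =
        if j = i then 1 else 0 := by
      intro i
      rw [ev_res, F.ev_nat hV (d i) V le_rfl W' h (e j), hd]
      split_ifs <;> simp
    simp_rw [this]
    simp
  conv_rhs => rw [hl]
  rw [F.dual.ev_lin, res_sum]
  simp_rw [F.res_smul]
  rw [F.ev_lin]
  refine Finset.sum_congr rfl fun i _ => ?_
  rw [F.dual.ev_nat hV χ V le_rfl W' h (d i), mul_comm]

/-- The dual of a module of finite type is reflexive. -/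
lemma dual_isReflexive (hO : IsGoodO O) (hR : IsRedO O) {E : OModuleOn O U}
    (hE : E.IsFiniteType) : E.dual.IsReflexive := by
  have van : ∀ (W : Opens α) (hW : W ≤ U) (Θ : E.dual.dual.dual.sec W hW),
      (∀ W' h (s : E.sec W' (h.trans hW)),
        E.dual.dual.ev hW Θ W' h (E.toBi _ s) = 0) →
      ∀ W' h χ, E.dual.dual.ev hW Θ W' h χ = 0 := by
    intro W hW Θ hΘ W' h χ
    by_contra hne
    obtain ⟨V, hV, ⟨x, hx⟩, hu⟩ := hR.unit _ _ hne
    obtain ⟨W₁, hW₁, hx₁, n, s, hs⟩ := hE x ((hV.trans (h.trans hW)) hx)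
    obtain ⟨V₂, hV₂, hne₂, m, e, he, hrel⟩ := exists_free hR n (V ⊓ W₁)
      (inf_le_right.trans hW₁) ⟨x, hx, hx₁⟩ _ (hs.mono (inf_le_right : V ⊓ W₁ ≤ W₁))
    have hV₂V : V₂ ≤ V := hV₂.trans inf_le_left
    obtain ⟨t, ht⟩ := evalHom_surjective_of_free hO _ e he hrel
      (E.dual.dual.res (h.trans hW) (hV₂V.trans hV) χ)
    have h0 := hΘ V₂ ((hV₂V.trans hV).trans h) t
    rw [ht, E.dual.dual.ev_nat hW Θ W' h V₂ (hV₂V.trans hV) χ, ← map_map_apply _ hV hV₂V] at h0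
    have hu2 := hu.map (O.map (homOfLE hV₂V).op).hom
    have := hR.nontriv V₂ hne₂
    exact hu2.ne_zero h0
  intro W hW
  constructor
  · intro φ ψ hφψ
    refine E.ev_ext hW fun W' h s => ?_
    have h1 : E.dual.dual.ev hW (E.dual.toBi hW φ) W' h (E.toBi _ s) =
        E.dual.dual.ev hW (E.dual.toBi hW ψ) W' h (E.toBi _ s) :=
      congrArg (fun X => E.dual.dual.ev hW X W' h (E.toBi _ s)) hφψ
    rw [ev_toBi, ev_toBi, ev_toBi, ev_toBi, E.res_id] at h1
    exact h1
  · intro Ψ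
    let φ : E.dual.sec W hW := E.mkDual hW
      (fun W' h s => E.dual.dual.ev hW Ψ W' h (E.toBi _ s))
      (by
        intro W' h s t
        rw [toBi_add]
        exact E.dual.dual.ev_add hW Ψ W' h _ _)
      (by
        intro W' h r s
        rw [toBi_smul]
        exact E.dual.dual.ev_smul hW Ψ W' h _ _)
      (by
        intro W' h W'' h' s
        rw [toBi_res]
        exact E.dual.dual.ev_nat hW Ψ W' h W'' h' _)
    refine ⟨φ, ?_⟩
    let Ψ' : E.dual.dual.dual.sec W hW := Ψ
    let Φ : E.dual.dual.dual.sec W hW := E.dual.toBi hW φ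
    change Φ = Ψ'
    rw [← sub_eq_zero]
    have hsub : ∀ W' h χ, E.dual.dual.ev hW (Φ - Ψ') W' h χ =
        E.dual.dual.ev hW Φ W' h χ - E.dual.dual.ev hW Ψ' W' h χ := by
      intro W' h χ
      rw [eq_sub_iff_add_eq, ← add_ev, sub_add_cancel]
    refine E.dual.dual.ev_ext hW fun W' h χ => ?_
    rw [zero_ev]
    refine van W hW (Φ - Ψ') (fun W' h s => ?_) W' h χ
    rw [hsub, sub_eq_zero]
    have e1 : E.dual.dual.ev hW Φ W' h (E.toBi _ s) =
      E.ev hW φ W' h (E.res (h.trans hW) le_rfl s) := rfl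
    rw [e1, E.res_id]
    rfl

end OModuleOn

namespace OModuleHom
variable {O : (Opens α)ᵒᵖ ⥤ CommRingCat.{u}} {U : Opens α} {F G H : OModuleOn O U}

/-- Composition of morphisms. -/
def comp (φ : OModuleHom F G) (ψ : OModuleHom G H) : OModuleHom F H where
  app W hW s := ψ.app W hW (φ.app W hW s)
  app_add W hW s t := by rw [φ.app_add, ψ.app_add]
  app_smul W hW r s := by rw [φ.app_smul, ψ.app_smul]
  naturality hW h s := by rw [φ.naturality, ψ.naturality]

lemma IsIso.comp {φ : OModuleHom F G} {ψ : OModuleHom G H} (hφ : φ.IsIso) (hψ : ψ.IsIso) :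
    (φ.comp ψ).IsIso := fun W hW => (hψ W hW).comp (hφ W hW)

lemma IsIso.exists_inv {φ : OModuleHom F G} (hφ : φ.IsIso) :
    ∃ ψ : OModuleHom G F, ψ.IsIso ∧ (∀ W hW s, ψ.app W hW (φ.app W hW s) = s) ∧
      (∀ W hW s, φ.app W hW (ψ.app W hW s) = s) := by
  choose g hg using fun W hW => (Function.bijective_iff_has_inverse.1 (hφ W hW))
  refine ⟨⟨g, ?_, ?_, ?_⟩, ?_, fun W hW => (hg W hW).1, fun W hW => (hg W hW).2⟩
  · intro W hW s t
    apply (hφ W hW).1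
    rw [φ.app_add, (hg W hW).2, (hg W hW).2, (hg W hW).2]
  · intro W hW r s
    apply (hφ W hW).1
    rw [φ.app_smul, (hg W hW).2, (hg W hW).2]
  · intro W W' hW h s
    apply (hφ _ _).1
    rw [φ.naturality, (hg _ _).2, (hg W hW).2]
  · intro W hW
    exact Function.bijective_iff_has_inverse.2 ⟨φ.app W hW, (hg W hW).2, (hg W hW).1⟩

end OModuleHom

namespace OModuleOn
variable {O : (Opens α)ᵒᵖ ⥤ CommRingCat.{u}} {U : Opens α}

/-- Pullback of a functional along a morphism. -/
def pb {A F : OModuleOn O U} (φ : OModuleHom A F) {W : Opens α} (hW : W ≤ U)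
    (l : F.dual.sec W hW) : A.dual.sec W hW :=
  A.mkDual hW (fun W' h s => F.ev hW l W' h (φ.app W' _ s))
    (by intro W' h s t; rw [φ.app_add, ev_add])
    (by intro W' h r s; rw [φ.app_smul, ev_smul])
    (by intro W' h W'' h' s; rw [φ.naturality, ev_nat])

lemma ev_pb {A F : OModuleOn O U} (φ : OModuleHom A F) {W : Opens α} (hW : W ≤ U)
    (l : F.dual.sec W hW) (W' h s) :
    A.ev hW (pb φ hW l) W' h s = F.ev hW l W' h (φ.app W' _ s) := rfl

/-- The transpose of a morphism. -/
def pbHom {A F : OModuleOn O U} (φ : OModuleHom A F) : OModuleHom F.dual A.dual where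
  app W hW l := pb φ hW l
  app_add W hW l l' := rfl
  app_smul W hW r l := rfl
  naturality hW h l := rfl

lemma isReflexive_of_iso {A F : OModuleOn O U} (φ : OModuleHom A F) (hφ : φ.IsIso)
    (hF : F.IsReflexive) : A.IsReflexive := by
  obtain ⟨ψ, -, h1, h2⟩ := hφ.exists_inv
  intro W hW
  constructor
  · intro s s' hs
    apply (hφ W hW).1
    apply (hF W hW).1
    refine F.dual.ev_ext hW fun W' h l => ?_
    have h3 : A.dual.ev hW (A.toBi hW s) W' h (pb φ _ l) =
      A.dual.ev hW (A.toBi hW s') W' h (pb φ _ l) :=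
      congrArg (fun X => A.dual.ev hW X W' h (pb φ _ l)) hs
    rw [ev_toBi, ev_toBi, ev_pb, ev_pb, φ.naturality, φ.naturality] at h3
    exact h3
  · intro χ
    let χ₀ : A.dual.dual.sec W hW := χ
    obtain ⟨f, hf⟩ := (hF W hW).2 (pb (pbHom φ) hW χ₀)
    refine ⟨ψ.app W hW f, ?_⟩
    refine A.dual.ev_ext hW fun W' h μ => ?_
    have h3 : F.dual.ev hW (F.toBi hW f) W' h (pb ψ _ μ) =
      F.dual.ev hW (pb (pbHom φ) hW χ₀) W' h (pb ψ _ μ) :=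
      congrArg (fun X => F.dual.ev hW X W' h (pb ψ _ μ)) hf
    rw [ev_toBi, ev_pb, ev_pb, ψ.naturality] at h3
    have h4 : (pbHom φ).app W' (h.trans hW) (pb ψ (h.trans hW) μ) = μ := by
      refine A.ev_ext _ fun W'' h' s => ?_
      change A.ev (h.trans hW) μ W'' h' (ψ.app W'' _ (φ.app W'' _ s)) = _
      rw [h1]
    rw [h4] at h3
    exact h3

lemma restrict_bidual_iso {V : Opens α} (G : OModuleOn O U) (hV : V ≤ U) (F : OModuleOn O V)
    (hF : F.IsReflexive) (hGF : AreIsomorphic (G.restrictTo hV) F) :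
    AreIsomorphic (G.bidual.restrictTo hV) F := by
  obtain ⟨φ, hφ⟩ := hGF
  have hA := isReflexive_of_iso φ hφ hF
  obtain ⟨ψ, hψ, -⟩ := OModuleHom.IsIso.exists_inv hA
  exact ⟨(show OModuleHom (G.bidual.restrictTo hV) (G.restrictTo hV) from ψ).comp φ,
    OModuleHom.IsIso.comp hψ hφ⟩

lemma dual_res_bijective (E : OModuleOn O (⊤ : Opens α))
    (hH : ∀ V : Opens α, Function.Bijective (O.map (homOfLE (inf_le_right : U ⊓ V ≤ V)).op))
    (V : Opens α) (hV : V ≤ ⊤) :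
    Function.Bijective (E.dual.res hV (inf_le_right : U ⊓ V ≤ V)) := by
  constructor
  · intro φ ψ h
    refine E.ev_ext hV fun W' h' s => ?_
    apply (hH W').1
    rw [← ev_nat, ← ev_nat]
    exact congrArg (fun X => E.ev _ X (U ⊓ W') (inf_le_inf_left U h')
      (E.res (h'.trans hV) inf_le_right s)) h
  · intro φ
    choose g hg using fun W => (hH W).2
    let app : ∀ (W' : Opens α) (h : W' ≤ V), E.sec W' (h.trans hV) → O.obj (op W') :=
      fun W' h s => g W' (E.ev _ φ (U ⊓ W') (inf_le_inf_left U h)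
        (E.res (h.trans hV) inf_le_right s))
    have happ : ∀ W' h s, O.map (homOfLE (inf_le_right : U ⊓ W' ≤ W')).op (app W' h s) =
        E.ev _ φ (U ⊓ W') (inf_le_inf_left U h) (E.res (h.trans hV) inf_le_right s) :=
      fun W' h s => hg W' _
    refine ⟨E.mkDual hV app ?_ ?_ ?_, ?_⟩
    · intro W' h s t
      apply (hH W').1
      rw [map_add, happ _ h, happ _ h, happ _ h, E.res_add, ev_add]
    · intro W' h r s
      apply (hH W').1
      rw [map_mul, happ _ h, happ _ h, E.res_smul, ev_smul]
    · intro W' h W'' h' s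
      apply (hH W'').1
      rw [happ _ (h'.trans h), E.res_comp, map_map_apply,
        ← map_map_apply O (inf_le_right : U ⊓ W' ≤ W') (inf_le_inf_left U h'), happ _ h, ← ev_nat,
        E.res_comp]
    · refine E.ev_ext _ fun W' h s => ?_
      rw [ev_res, ev_mkDual]
      apply (hH W').1
      rw [happ _ (h.trans inf_le_right), ← ev_nat]

lemma pushforward_iso (R : OModuleOn O (⊤ : Opens α)) (F : OModuleOn O U)
    (hb : ∀ V hV, Function.Bijective (R.res hV (inf_le_right : U ⊓ V ≤ V)))
    (h : AreIsomorphic (R.restrictTo (le_top : U ≤ ⊤)) F) : AreIsomorphic R F.pushforward := by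
  obtain ⟨θ, hθ⟩ := h
  refine ⟨⟨fun V hV s => θ.app (U ⊓ V) inf_le_left (R.res hV inf_le_right s), ?_, ?_, ?_⟩, ?_⟩
  · intro V hV s t
    rw [R.res_add]
    exact θ.app_add _ _ _ _
  · intro V hV r s
    rw [R.res_smul]
    exact θ.app_smul _ _ _ _
  · intro V V' hV h s
    have := θ.naturality (inf_le_left : U ⊓ V ≤ U) (inf_le_inf_left U h) (R.res hV inf_le_right s)
    refine Eq.trans ?_ this
    congr 1
    exact (R.res_comp _ _ _ _).trans (R.res_comp _ _ _ _).symm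
  · intro V hV
    exact (hθ _ _).comp (hb V hV)

end OModuleOn

section SchemeInputs

lemma affine_surj {X : Scheme.{u}} {V : X.Opens} (hV : IsAffineOpen V) (g : Γ(X, V))
    (s : Γ(X, X.basicOpen g)) : ∃ (n : ℕ) (a : Γ(X, V)),
      X.presheaf.map (homOfLE (X.basicOpen_le g)).op (g ^ n) * s =
        X.presheaf.map (homOfLE (X.basicOpen_le g)).op a := by
  have := hV.isLocalization_basicOpen g
  obtain ⟨n, a, h⟩ := IsLocalization.Away.surj g s
  exact ⟨n, a, by rw [mul_comm, map_pow]; exact h⟩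

lemma affine_zero {X : Scheme.{u}} {V : X.Opens} (hV : IsAffineOpen V) (g : Γ(X, V))
    (a : Γ(X, V)) (h : X.presheaf.map (homOfLE (X.basicOpen_le g)).op a = 0) :
    ∃ n : ℕ, g ^ n * a = 0 := by
  have := hV.isLocalization_basicOpen g
  obtain ⟨⟨_, n, rfl⟩, h⟩ := (IsLocalization.map_eq_zero_iff (Submonoid.powers g) _ a).1 h
  exact ⟨n, h⟩

lemma isUnit_basicOpen {X : Scheme.{u}} {V : X.Opens} (g : Γ(X, V)) :
    IsUnit (X.presheaf.map (homOfLE (X.basicOpen_le g)).op g) :=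
  RingedSpace.isUnit_res_basicOpen _ g

lemma isRedO_scheme (X : Scheme.{u}) [IsReduced X] : IsRedO (α := X) X.presheaf where
  unit W r hr := by
    refine ⟨X.basicOpen r, X.basicOpen_le r, ?_, isUnit_basicOpen r⟩
    by_contra h
    exact hr (eq_zero_of_basicOpen_eq_bot r ((Opens.not_nonempty_iff_eq_bot _).1 h))
  nontriv W hW := by
    obtain ⟨x, hx⟩ := hW
    exact (X.presheaf.germ W x hx).hom.domain_nontrivial

lemma isCohO_scheme (X : Scheme.{u}) [IsLocallyNoetherian X] : IsCohO (α := X) X.presheaf := by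
  intro W q p M x hx
  obtain ⟨V, hVa, hxV, hVW⟩ := (X.isBasis_affineOpens).exists_subset_of_mem_open hx W.isOpen
  obtain ⟨V, hV, rfl⟩ : ∃ V' : X.Opens, IsAffineOpen V' ∧ (V' : Set X) = V := by
    obtain ⟨V', h, rfl⟩ := hVa; exact ⟨V', h, rfl⟩
  have hVW : V ≤ W := hVW
  have : IsNoetherianRing Γ(X, V) := IsLocallyNoetherian.component_noetherian ⟨V, hV⟩
  let N : Fin q → Fin p → Γ(X, V) := fun i k => X.presheaf.map (homOfLE hVW).op (M i k)
  let T : (Fin q → Γ(X, V)) →ₗ[Γ(X, V)] (Fin p → Γ(X, V)) :=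
    LinearMap.pi fun k => ∑ i, (N i k) • LinearMap.proj i
  have hT : ∀ v k, T v k = ∑ i, v i * N i k := by
    intro v k
    simp [T, mul_comm]
  obtain ⟨m, t, ht⟩ := Submodule.fg_iff_exists_fin_generating_family.1
    (IsNoetherian.noetherian (LinearMap.ker T))
  have htk : ∀ j, t j ∈ LinearMap.ker T := fun j => ht ▸ Submodule.subset_span ⟨j, rfl⟩
  refine ⟨V, hVW, hxV, m, t, fun j k => ?_, ?_⟩
  · rw [← hT, (LinearMap.mem_ker.1 (htk j))]; rfl
  intro V' h' a ha y hy
  obtain ⟨g, hg, hyg⟩ := hV.exists_basicOpen_le ⟨y, hy⟩ (h' hy)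
  refine ⟨X.basicOpen g, hg, hyg, ?_⟩
  have hgV := X.basicOpen_le g
  choose n b hb using fun i => affine_surj hV g (X.presheaf.map (homOfLE hg).op (a i))
  -- uniform denominator
  let ρ := X.presheaf.map (homOfLE hgV).op
  let n₀ := ∑ i, n i
  let b' : Fin q → Γ(X, V) := fun i => g ^ (n₀ - n i) * b i
  have hb' : ∀ i, ρ (g ^ n₀) * X.presheaf.map (homOfLE hg).op (a i) = ρ (b' i) := by
    intro i
    have hle : n i ≤ n₀ := Finset.single_le_sum (f := n) (fun _ _ => Nat.zero_le _)
      (Finset.mem_univ i)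
    show _ = ρ (g ^ (n₀ - n i) * b i)
    rw [map_mul, ← hb i, ← mul_assoc, ← map_mul, ← pow_add, Nat.sub_add_cancel hle]
  have hz : ∀ k, ρ (T b' k) = 0 := by
    intro k
    rw [hT, map_sum]
    have := congrArg (fun z => ρ (g ^ n₀) * X.presheaf.map (homOfLE hg).op z) (ha k)
    simp only [map_sum, map_zero, mul_zero, Finset.mul_sum] at this
    rw [← this]
    refine Finset.sum_congr rfl fun i _ => ?_
    rw [show ρ (b' i * N i k) = ρ (b' i) * ρ (N i k) from map_mul _ _ _, ← hb', mul_assoc]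
    refine congrArg _ (Eq.trans ?_ (map_mul (X.presheaf.map (homOfLE hg).op).hom _ _).symm)
    exact congrArg _ ((map_map_apply _ _ _ _).trans (map_map_apply _ _ _ _).symm)
  choose l hl using fun k => affine_zero hV g _ (hz k)
  let l₀ := ∑ k, l k
  have hker : g ^ l₀ • b' ∈ LinearMap.ker T := by
    rw [LinearMap.mem_ker, map_smul]
    funext k
    have hle : l k ≤ l₀ := Finset.single_le_sum (f := l) (fun _ _ => Nat.zero_le _)
      (Finset.mem_univ k)
    show g ^ l₀ * T b' k = 0
    rw [← Nat.sub_add_cancel hle, pow_add, mul_assoc, hl, mul_zero]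
  rw [← ht, Submodule.mem_span_range_iff_exists_fun] at hker
  obtain ⟨c, hc⟩ := hker
  have hu : IsUnit (ρ (g ^ (l₀ + n₀))) := by
    rw [map_pow]; exact (isUnit_basicOpen g).pow _
  obtain ⟨u, hu⟩ := hu
  refine ⟨fun j => ↑u⁻¹ * ρ (c j), fun i => ?_⟩
  apply u.isUnit.mul_left_cancel
  have := congrFun hc i
  simp only [Finset.sum_apply, Pi.smul_apply, smul_eq_mul] at this
  have := congrArg ρ this
  rw [map_mul, ← hb', ← mul_assoc, ← map_mul, ← pow_add, ← hu, map_sum] at this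
  refine this.symm.trans ?_
  rw [Finset.mul_sum]
  refine Finset.sum_congr rfl fun j _ => ?_
  rw [map_mul, ← mul_assoc, ← mul_assoc, u.mul_inv, one_mul]

lemma two_le_coheight {X : Scheme.{u}} {U : X.Opens}
    (hZ : hasEverywhereCodimAtLeastTwo ((U : Set X)ᶜ)) (x : X) (hx : x ∉ U) :
    2 ≤ Order.coheight x := by
  let Y := irreducibleComponent x
  let y : Y := ⟨x, mem_irreducibleComponent⟩
  let C : IrreducibleCloseds Y := ⟨closure {y}, isIrreducible_singleton.closure, isClosed_closure⟩
  have h1 := hZ Y (irreducibleComponent_mem_irreducibleComponents x) C (by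
    refine closure_minimal (by simpa using hx) ?_
    exact U.isOpen.isClosed_compl.preimage continuous_subtype_val)
  refine h1.trans ?_
  have h2 := Order.coheight_le_coheight_apply_of_strictMono
    (IrreducibleCloseds.map (f := (Subtype.val : Y → X)) continuous_subtype_val)
    (IrreducibleCloseds.map_strictMono_of_isInducing Topology.IsInducing.subtypeVal) C
  refine h2.trans ?_
  rw [← Order.coheight_orderIso (irreducibleSetEquivPoints (α := X)).symm x]
  apply le_of_eq
  congr 1
  ext1
  show closure (Subtype.val '' closure {y}) = closure {x}
  rw [closure_image_closure continuous_subtype_val, Set.image_singleton]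

lemma mem_of_dim_le_one {X : Scheme.{u}} {U : X.Opens}
    (hZ : hasEverywhereCodimAtLeastTwo ((U : Set X)ᶜ)) (x : X)
    (h : ringKrullDim (X.presheaf.stalk x) ≤ 1) : x ∈ U := by
  by_contra hx
  have := two_le_coheight hZ x hx
  rw [ringKrullDim_stalk_eq_coheight] at h
  have h' : Order.coheight x ≤ 1 := by exact_mod_cast h
  exact absurd (this.trans h') (by decide)

end SchemeInputs

section Algebra

lemma ringKrullDim_le_one_aux {R : Type*} [CommRing R] [IsDomain R] [IsLocalRing R]
    [IsNoetherianRing R] [IsIntegrallyClosed R] (a b : R) (hab : ¬ b ∣ a) (hb : b ≠ 0)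
    (hm : ∀ z ∈ IsLocalRing.maximalIdeal R, b ∣ z * a) : ringKrullDim R ≤ 1 := by
  have hbm : b ∈ IsLocalRing.maximalIdeal R := by
    rw [IsLocalRing.mem_maximalIdeal, mem_nonunits_iff]
    exact fun hu => hab hu.dvd
  by_cases hc : ∃ z ∈ IsLocalRing.maximalIdeal R, ∃ w, IsUnit w ∧ z * a = b * w
  · obtain ⟨z, hz, w, ⟨w, rfl⟩, hzw⟩ := hc
    have hspan : IsLocalRing.maximalIdeal R = Ideal.span {z} := by
      apply le_antisymm
      · intro y hy
        obtain ⟨v, hv⟩ := hm y hy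
        rw [Ideal.mem_span_singleton]
        refine ⟨v * ↑w⁻¹, ?_⟩
        have h1 : b * (y * w) = b * (z * v) := by linear_combination z * hv - y * hzw
        have h2 := mul_left_cancel₀ hb h1
        rw [← mul_assoc, ← h2, mul_assoc, w.mul_inv, mul_one]
      · rw [Ideal.span_singleton_le_iff_mem]; exact hz
    have : (IsLocalRing.maximalIdeal R).IsPrincipal := ⟨z, hspan⟩
    rw [← IsLocalRing.maximalIdeal_height_eq_ringKrullDim]
    have := Ideal.height_le_one_of_isPrincipal_of_mem_minimalPrimes
      (IsLocalRing.maximalIdeal R) (IsLocalRing.maximalIdeal R)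
      (by rw [Ideal.minimalPrimes_eq_subsingleton_self]; rfl)
    exact_mod_cast this
  · exfalso
    push Not at hc
    have hbK : algebraMap R (FractionRing R) b ≠ 0 := by
      rwa [Ne, FaithfulSMul.algebraMap_eq_zero_iff]
    let x : (FractionRing R) := algebraMap R (FractionRing R) a / algebraMap R (FractionRing R) b
    let N : Submodule R (FractionRing R) := Submodule.map (Algebra.linearMap R (FractionRing R)) (IsLocalRing.maximalIdeal R)
    have hN : N.FG := (IsNoetherian.noetherian (IsLocalRing.maximalIdeal R)).map _
    have hx : IsIntegral R x := by
      refine isIntegral_of_smul_mem_submodule (N := N) ?_ hN x ?_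
      · refine fun h => hbK ?_
        have : algebraMap R (FractionRing R) b ∈ N := ⟨b, hbm, rfl⟩
        rw [h] at this
        simpa using this
      · rintro _ ⟨z, hz, rfl⟩
        obtain ⟨w, hw⟩ := hm z hz
        refine ⟨w, ?_, ?_⟩
        · by_contra hwm
          exact hc z hz w (by simpa using hwm) hw
        · have := congrArg (algebraMap R (FractionRing R)) hw
          rw [map_mul, map_mul] at this
          show algebraMap R (FractionRing R) w = algebraMap R (FractionRing R) a /
            algebraMap R (FractionRing R) b * algebraMap R (FractionRing R) z
          rw [div_mul_eq_mul_div, eq_div_iff hbK]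
          linear_combination -this
    obtain ⟨e, he⟩ := IsIntegrallyClosed.isIntegral_iff.1 hx
    apply hab
    refine ⟨e, IsFractionRing.injective R (FractionRing R) ?_⟩
    rw [map_mul, he, mul_div_cancel₀ _ hbK]

lemma exists_prime_aux {A : Type*} [CommRing A] [IsNoetherianRing A] (a b : A) (hab : ¬ b ∣ a) :
    ∃ (p : Ideal A) (_ : p.IsPrime) (a' : A), (∀ z, z ∈ p ↔ b ∣ z * a') ∧
      ∀ z, b ∣ z * a → z ∈ p := by
  have key : ∀ (y z : A), z ∈ (⊥ : Submodule A (A ⧸ Ideal.span {b})).colon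
      {Ideal.Quotient.mk (Ideal.span {b}) y} ↔ b ∣ z * y := by
    intro y z
    rw [Submodule.mem_colon_singleton, Submodule.mem_bot, ← Ideal.mem_span_singleton,
      ← Ideal.Quotient.eq_zero_iff_mem, map_mul]
    rfl
  obtain ⟨p, hp, hle⟩ := exists_le_isAssociatedPrime_of_isNoetherianRing A
    (Ideal.Quotient.mk (Ideal.span {b}) a) (by
      rwa [Ne, Ideal.Quotient.eq_zero_iff_mem, Ideal.mem_span_singleton])
  rw [isAssociatedPrime_iff] at hp
  obtain ⟨hp, y, hy⟩ := hp
  obtain ⟨a', rfl⟩ := Ideal.Quotient.mk_surjective y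
  exact ⟨p, hp, a', fun z => by rw [hy, key], fun z hz => hle ((key a z).2 hz)⟩

lemma ringKrullDim_le_one_loc {A R : Type*} [CommRing A] [IsDomain A] [IsNoetherianRing A]
    [CommRing R] [IsDomain R] [IsIntegrallyClosed R] [Algebra A R] (p : Ideal A) [p.IsPrime]
    [IsLocalization.AtPrime R p] (a b : A) (hb : b ≠ 0) (hp : ∀ z, z ∈ p ↔ b ∣ z * a) :
    ringKrullDim R ≤ 1 := by
  have : IsLocalRing R := IsLocalization.AtPrime.isLocalRing R p
  have : IsNoetherianRing R := IsLocalization.isNoetherianRing p.primeCompl R inferInstance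
  have hinj : Function.Injective (algebraMap A R) :=
    IsLocalization.injective R p.primeCompl_le_nonZeroDivisors
  refine ringKrullDim_le_one_aux (algebraMap A R a) (algebraMap A R b) ?_ ?_ ?_
  · rintro ⟨e, he⟩
    obtain ⟨⟨c, s⟩, hs⟩ := IsLocalization.surj p.primeCompl e
    apply s.2
    rw [SetLike.mem_coe, hp]
    refine ⟨c, hinj ?_⟩
    rw [map_mul, map_mul, he]
    linear_combination algebraMap A R b * hs
  · rwa [Ne, map_eq_zero_iff _ hinj]
  · intro z hz
    obtain ⟨⟨c, s⟩, hs⟩ := IsLocalization.surj p.primeCompl z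
    have hc : c ∈ p := by
      rw [← IsLocalization.AtPrime.to_map_mem_maximal_iff R p c]
      have := Ideal.mul_mem_right (algebraMap A R s) _ hz
      rwa [hs] at this
    obtain ⟨e, he⟩ := (hp c).1 hc
    have hu := IsLocalization.map_units R s
    rw [← hu.dvd_mul_left (a := algebraMap A R b)]
    refine ⟨algebraMap A R e, ?_⟩
    rw [← map_mul, ← he, map_mul, ← hs]
    ring

end Algebra

section Hartogs

variable {X : Scheme.{u}}

lemma IsNormalScheme.isReduced (hX : IsNormalScheme X) : IsReduced X := by
  have : ∀ x : X, _root_.IsReduced (X.presheaf.stalk x) := fun x =>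
    have := (hX x).1
    inferInstance
  exact isReduced_of_isReduced_stalk X

lemma codim_dense [IsReduced X] {U : X.Opens}
    (hZ : hasEverywhereCodimAtLeastTwo ((U : Set X)ᶜ)) (W : X.Opens)
    (hW : (W : Set X).Nonempty) : ∃ y, y ∈ U ∧ y ∈ W := by
  obtain ⟨x, hx⟩ := hW
  have hirr : IsIrreducible (irreducibleComponent x) := isIrreducible_irreducibleComponent
  have hcl := hirr.closure_genericPoint isClosed_irreducibleComponent
  refine ⟨hirr.genericPoint, mem_of_dim_le_one hZ _ ?_, ?_⟩
  · have := isField_stalk_of_closure_mem_irreducibleComponents X hirr.genericPoint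
      (by rw [hcl]; exact irreducibleComponent_mem_irreducibleComponents x)
    rw [ringKrullDim_eq_zero_of_isField this]
    exact zero_le_one
  · have hs : hirr.genericPoint ⤳ x := by
      rw [specializes_iff_mem_closure, hcl]
      exact mem_irreducibleComponent
    exact hs.mem_open W.isOpen hx

lemma res_injective [IsReduced X] {U : X.Opens}
    (hZ : hasEverywhereCodimAtLeastTwo ((U : Set X)ᶜ)) (V : X.Opens) :
    Function.Injective (X.presheaf.map (homOfLE (inf_le_right : U ⊓ V ≤ V)).op) := by
  rw [injective_iff_map_eq_zero]
  intro h h0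
  by_contra hne
  have hn : ((X.basicOpen h : X.Opens) : Set X).Nonempty := by
    by_contra hn
    exact hne (eq_zero_of_basicOpen_eq_bot h ((Opens.not_nonempty_iff_eq_bot _).1 hn))
  obtain ⟨y, hyU, hyh⟩ := codim_dense hZ _ hn
  have h1 := Scheme.basicOpen_res X h (homOfLE (inf_le_right : U ⊓ V ≤ V)).op
  rw [h0, Scheme.basicOpen_zero] at h1
  have : y ∈ U ⊓ V ⊓ X.basicOpen h := ⟨⟨hyU, X.basicOpen_le h hyh⟩, hyh⟩
  rw [← h1] at this
  exact this

lemma affine_inj {V : X.Opens} (hV : IsAffineOpen V) [IsDomain Γ(X, V)] (g : Γ(X, V))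
    (hg : g ≠ 0) :
    Function.Injective (X.presheaf.map (homOfLE (X.basicOpen_le g)).op) := by
  rw [injective_iff_map_eq_zero]
  intro a ha
  obtain ⟨n, hn⟩ := affine_zero hV g a ha
  exact (mul_eq_zero.1 hn).resolve_left (pow_ne_zero _ hg)

lemma ne_zero_of_mem {V : X.Opens} {g : Γ(X, V)} {y : X} (hy : y ∈ X.basicOpen g) : g ≠ 0 := by
  rintro rfl
  rw [Scheme.basicOpen_zero] at hy
  exact hy

/-- Comparison of two fractional representations of the same section. -/
lemma frac_compare {V W : X.Opens} (hV : IsAffineOpen V) [IsDomain Γ(X, V)]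
    (s : Γ(X, W)) (b g : Γ(X, V)) (hb0 : b ≠ 0) (hg0 : g ≠ 0)
    (hb : X.basicOpen b ≤ W) (hg : X.basicOpen g ≤ W) (B a C c : Γ(X, V))
    (h1 : X.presheaf.map (homOfLE (X.basicOpen_le b)).op B * X.presheaf.map (homOfLE hb).op s =
      X.presheaf.map (homOfLE (X.basicOpen_le b)).op a)
    (h2 : X.presheaf.map (homOfLE (X.basicOpen_le g)).op C * X.presheaf.map (homOfLE hg).op s =
      X.presheaf.map (homOfLE (X.basicOpen_le g)).op c) : C * a = B * c := by
  apply affine_inj hV (b * g) (mul_ne_zero hb0 hg0)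
  have e := X.basicOpen_mul b g
  have eb : X.basicOpen (b * g) ≤ X.basicOpen b := e ▸ inf_le_left
  have eg : X.basicOpen (b * g) ≤ X.basicOpen g := e ▸ inf_le_right
  have h1' := congrArg (X.presheaf.map (homOfLE eb).op) h1
  have h2' := congrArg (X.presheaf.map (homOfLE eg).op) h2
  rw [map_mul, map_map_apply, map_map_apply, map_map_apply] at h1' h2'
  rw [map_mul, map_mul, ← h1', ← h2']
  ring

lemma exists_affine_domain [IsLocallyNoetherian X] (hX : IsNormalScheme X) (V : X.Opens) (x : X)
    (hx : x ∈ V) : ∃ A : X.Opens, IsAffineOpen A ∧ A ≤ V ∧ x ∈ A ∧ IsDomain Γ(X, A) := by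
  obtain ⟨A, hxA, hA, hAV, hinj⟩ := X.exists_le_and_germ_injective x V hx
  have := (hX x).1
  exact ⟨A, hA, hAV, hxA, hinj.isDomain (X.presheaf.germ A x hxA).hom⟩

lemma hartogs_local [IsLocallyNoetherian X] (hX : IsNormalScheme X) {U : X.Opens}
    (hZ : hasEverywhereCodimAtLeastTwo ((U : Set X)ᶜ)) (A : X.Opens) (hA : IsAffineOpen A)
    [IsDomain Γ(X, A)] (hne : (A : Set X).Nonempty) (s : Γ(X, U ⊓ A)) :
    ∃ e : Γ(X, A), X.presheaf.map (homOfLE (inf_le_right : U ⊓ A ≤ A)).op e = s := by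
  have := hX.isReduced
  have : IsNoetherianRing Γ(X, A) := IsLocallyNoetherian.component_noetherian ⟨A, hA⟩
  -- local fractional representation
  have hloc : ∀ y ∈ U ⊓ A, ∃ (g : Γ(X, A)) (hg : X.basicOpen g ≤ U ⊓ A), y ∈ X.basicOpen g ∧
      ∃ (n : ℕ) (c : Γ(X, A)), X.presheaf.map (homOfLE (X.basicOpen_le g)).op (g ^ n) *
        X.presheaf.map (homOfLE hg).op s = X.presheaf.map (homOfLE (X.basicOpen_le g)).op c := by
    intro y hy
    obtain ⟨g, hg, hyg⟩ := hA.exists_basicOpen_le ⟨y, hy⟩ hy.2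
    exact ⟨g, hg, hyg, affine_surj hA g _⟩
  obtain ⟨y₀, hy₀U, hy₀A⟩ := codim_dense hZ A hne
  obtain ⟨b, hb, hyb, n, a, hab⟩ := hloc y₀ ⟨hy₀U, hy₀A⟩
  have hb0 := ne_zero_of_mem hyb
  have hdvd : b ^ n ∣ a := by
    by_contra hnd
    obtain ⟨p, hp, a', hpa, hpz⟩ := exists_prime_aux a (b ^ n) hnd
    let P : PrimeSpectrum Γ(X, A) := ⟨p, hp⟩
    have hyA : hA.fromSpec P ∈ A := by
      have : hA.fromSpec P ∈ Set.range hA.fromSpec := ⟨P, rfl⟩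
      rwa [hA.range_fromSpec] at this
    have hyU : hA.fromSpec P ∈ U := by
      apply mem_of_dim_le_one hZ
      let _ := TopCat.Presheaf.algebra_section_stalk X.presheaf ⟨_, hyA⟩
      have h1 : IsLocalization.AtPrime (X.presheaf.stalk (hA.fromSpec P)) p :=
        hA.isLocalization_stalk' P hyA
      have := (hX (hA.fromSpec P)).1
      have := (hX (hA.fromSpec P)).2
      exact ringKrullDim_le_one_loc p a' (b ^ n) (pow_ne_zero _ hb0) hpa
    obtain ⟨g, hg, hyg, m, c, hc⟩ := hloc _ ⟨hyU, hyA⟩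
    have hcmp := frac_compare hA s b g hb0 (ne_zero_of_mem hyg) hb hg _ _ _ _ hab hc
    have hgp : g ∈ p := hp.mem_of_pow_mem m (hpz _ ⟨c, hcmp⟩)
    have h3 : P ∈ PrimeSpectrum.basicOpen g := by
      have := hA.fromSpec_preimage_basicOpen g
      rw [← this]
      exact hyg
    exact h3 hgp
  obtain ⟨e, rfl⟩ := hdvd
  refine ⟨e, (isGoodO_scheme X).sep₂ _ _ _ fun y hy => ?_⟩
  obtain ⟨g, hg, hyg, m, c, hc⟩ := hloc y hy
  have hcmp := frac_compare hA s b g hb0 (ne_zero_of_mem hyg) hb hg _ _ _ _ hab hc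
  have hce : c = g ^ m * e := by
    apply mul_left_cancel₀ (pow_ne_zero n hb0)
    rw [← hcmp]; ring
  refine ⟨X.basicOpen g, hg, hyg, ?_⟩
  rw [hce, map_mul] at hc
  have hu : IsUnit (X.presheaf.map (homOfLE (X.basicOpen_le g)).op (g ^ m)) := by
    rw [map_pow]; exact (isUnit_basicOpen g).pow m
  rw [map_map_apply]
  exact (hu.mul_left_cancel hc).symm

lemma hartogs [IsLocallyNoetherian X] (hX : IsNormalScheme X) {U : X.Opens}
    (hZ : hasEverywhereCodimAtLeastTwo ((U : Set X)ᶜ)) (V : X.Opens) :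
    Function.Bijective (X.presheaf.map (homOfLE (inf_le_right : U ⊓ V ≤ V)).op) := by
  have := hX.isReduced
  refine ⟨res_injective hZ V, fun s => ?_⟩
  obtain ⟨r, hr⟩ := (isGoodO_scheme X).glue V
    (fun W h r => X.presheaf.map (homOfLE (inf_le_right : U ⊓ W ≤ W)).op r =
      X.presheaf.map (homOfLE (inf_le_inf_left U h)).op s)
    (fun W' W'' h h' r hr => by
      have := congrArg (X.presheaf.map (homOfLE (inf_le_inf_left U h')).op) hr
      rw [map_map_apply, map_map_apply] at this
      rw [map_map_apply]
      exact this)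
    (fun W h r r' hr hr' => res_injective hZ W (hr.trans hr'.symm))
    (fun x hx => by
      obtain ⟨A, hA, hAV, hxA, hdom⟩ := exists_affine_domain hX V x hx
      exact ⟨A, hAV, hxA, hartogs_local hX hZ A hA ⟨x, hxA⟩ _⟩)
  refine ⟨r, (isGoodO_scheme X).sep₂ _ _ _ fun y hy => ?_⟩
  obtain ⟨A, hA, hAV, hxA, hdom⟩ := exists_affine_domain hX V y hy.2
  obtain ⟨e, he⟩ := hartogs_local hX hZ A hA ⟨y, hxA⟩
    (X.presheaf.map (homOfLE (inf_le_inf_left U hAV)).op s)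
  refine ⟨U ⊓ A, inf_le_inf_left U hAV, ⟨hy.1, hxA⟩, ?_⟩
  rw [← he, ← hr A hAV e he, map_map_apply, map_map_apply]

end Hartogs

lemma main_aux
    (X : Scheme.{u}) [IsLocallyNoetherian X] (hXnormal : IsNormalScheme X)
    (U : X.Opens) (hZ : hasEverywhereCodimAtLeastTwo ((U : Set X)ᶜ))
    (F : OModuleOn X.presheaf U) (hFrefl : F.IsReflexive)
    (G : OModuleOn X.presheaf (⊤ : TopologicalSpace.Opens X)) (hGcoh : G.IsCoherent)
    (hGF : OModuleOn.AreIsomorphic (G.restrictTo (le_top : U ≤ ⊤)) F) :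
    G.bidual.IsSheaf ∧ G.bidual.IsReflexive ∧ G.bidual.IsCoherent ∧
    OModuleOn.AreIsomorphic (G.bidual.restrictTo (le_top : U ≤ ⊤)) F ∧
    OModuleOn.AreIsomorphic G.bidual F.pushforward := by
  have := hXnormal.isReduced
  have hO := isGoodO_scheme X
  have hK := isCohO_scheme X
  have hR := isRedO_scheme X
  have hD := OModuleOn.dual_isCoherent hO hK hGcoh
  have hres := OModuleOn.restrict_bidual_iso G le_top F hFrefl hGF
  exact ⟨OModuleOn.dual_isSheaf hO G.dual, OModuleOn.dual_isReflexive hO hR hD.1,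
    OModuleOn.dual_isCoherent hO hK hD, hres,
    OModuleOn.pushforward_iso _ _ (OModuleOn.dual_res_bijective G.dual (hartogs hXnormal hZ)) hres⟩

open AlgebraicGeometry CategoryTheory

/-- Let `X` be a normal locally noetherian scheme that is locally of finite
type over a quotient `R₀/I` of a regular commutative ring `R₀`.  Let `U` be an open subscheme
of `X` whose complement has everywhere codimension at least `2` in `X`, and let `i : U → X` be
the inclusion.  Let `F` be a reflexive coherent sheaf of `O_U`-modules and let `G` be any
coherent `O_X`-module with `G|_U ≅ F`.  Then the bidual `G^∨∨` is a reflexive coherent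
`O_X`-module extending `F`, and `G^∨∨ ≅ i_* F`. -/
theorem bidual_is_pushforward_of_coherent_extension
    (X : Scheme.{u}) [IsLocallyNoetherian X] (hXnormal : IsNormalScheme X)
    (R₀ : Type u) [CommRing R₀] (hreg : IsRegularCommRing R₀) (I : Ideal R₀)
    (f : X ⟶ Spec (CommRingCat.of (R₀ ⧸ I))) [LocallyOfFiniteType f]
    (U : X.Opens) (hZ : hasEverywhereCodimAtLeastTwo ((U : Set X)ᶜ))
    (F : OModuleOn X.presheaf U) (hFsheaf : F.IsSheaf)
    (hFrefl : F.IsReflexive) (hFcoh : F.IsCoherent)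
    (G : OModuleOn X.presheaf (⊤ : TopologicalSpace.Opens X))
    (hGsheaf : G.IsSheaf) (hGcoh : G.IsCoherent)
    (hGF : OModuleOn.AreIsomorphic (G.restrictTo (le_top : U ≤ ⊤)) F) :
    G.bidual.IsSheaf ∧ G.bidual.IsReflexive ∧ G.bidual.IsCoherent ∧
    OModuleOn.AreIsomorphic (G.bidual.restrictTo (le_top : U ≤ ⊤)) F ∧
    OModuleOn.AreIsomorphic G.bidual F.pushforward := by
  exact main_aux X hXnormal U hZ F hFrefl G hGcoh hGF
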